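/- arXiv:math/0403422 — 4 statements merged into one kernel-verified Lean document; each statement's English description precedes it below -/
import Mathlib

section
/- For every fixed integer ℓ ≥ 1 there exists a constant C = C(ℓ) > 0 such that for every odd prime p, every integer N with 1 ≤ N < p/ℓ, and every a with a ≢ 0 (mod p), one has |G_ℓ(a,N) − (1/(p−1)) · binom(N−1, ℓ−1)| ≤ C · N^{3ℓ/4} · p^{(ℓ+6)/8} · (log p)^{(ℓ−2)/4}. -/
open Polynomial in
lemma finite_setOf_natDegree_le (F : Type*) [Semiring F] [Finite F] (n : ℕ) :
    {g : F[X] | g.natDegree ≤ n}.Finite := by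
  refine Set.Finite.of_finite_image (f := fun g : F[X] => fun i : Fin (n + 1) => g.coeff i)
    (Set.toFinite _) ?_
  intro g hg h hh hgh
  ext i
  by_cases hi : i < n + 1
  · exact congrFun hgh ⟨i, hi⟩
  · rw [coeff_eq_zero_of_natDegree_lt, coeff_eq_zero_of_natDegree_lt]
    · exact lt_of_le_of_lt hh (by omega)
    · exact lt_of_le_of_lt hg (by omega)

open Polynomial in
/-- The monic polynomials of degree `n` over a finite ring. -/
noncomputable def monicsOfDegree (F : Type*) [Semiring F] [Finite F] (n : ℕ) : Finset F[X] :=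
  ((finite_setOf_natDegree_le F n).subset
    (fun _ h => h.2.le : {g : F[X] | g.Monic ∧ g.natDegree = n} ⊆ _)).toFinset

open Polynomial in
/-- The monic irreducible polynomials of degree dividing `n`, for `n ≠ 0`. -/
noncomputable def irreduciblesOfDegreeDvd (F : Type*) [Field F] [Finite F] (n : ℕ) :
    Finset F[X] :=
  ((finite_setOf_natDegree_le F n).subset
    (fun _ h => h.2.2.2 : {g : F[X] | g.Monic ∧ Irreducible g ∧ g.natDegree ∣ n ∧
      g.natDegree ≤ n} ⊆ _)).toFinset

section
open Polynomial

variable {F : Type*} [Field F] [Finite F]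

lemma mem_monicsOfDegree {n : ℕ} {g : F[X]} :
    g ∈ monicsOfDegree F n ↔ g.Monic ∧ g.natDegree = n := by
  simp [monicsOfDegree]

lemma mem_irreduciblesOfDegreeDvd {n : ℕ} (hn : n ≠ 0) {g : F[X]} :
    g ∈ irreduciblesOfDegreeDvd F n ↔ g.Monic ∧ Irreducible g ∧ g.natDegree ∣ n := by
  simp only [irreduciblesOfDegreeDvd, Set.Finite.mem_toFinset, Set.mem_ofPred_eq]
  refine ⟨fun h => ⟨h.1, h.2.1, h.2.2.1⟩, fun h => ⟨h.1, h.2.1, h.2.2, ?_⟩⟩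
  exact Nat.le_of_dvd (Nat.pos_of_ne_zero hn) h.2.2

open UniqueFactorizationMonoid in
open Classical in
lemma natDegree_eq_sum_irreducibles {n : ℕ} {g : F[X]} (hg : g.Monic) (hn : g.natDegree = n) :
    n = ∑ k ∈ Finset.Icc 1 n, ∑ P ∈ irreduciblesOfDegreeDvd F k,
      if P ^ (k / P.natDegree) ∣ g then P.natDegree else 0 := by
  have hg0 := hg.ne_zero
  set T : Finset F[X] := ((finite_setOf_natDegree_le F n).subset
    (fun _ h => h.2.2 : {P : F[X] | P.Monic ∧ Irreducible P ∧ P.natDegree ≤ n} ⊆ _)).toFinset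
    with hT
  have memT : ∀ P, P ∈ T ↔ P.Monic ∧ Irreducible P ∧ P.natDegree ≤ n := by simp [hT]
  have hnf : ∀ P ∈ normalizedFactors g, P.Monic ∧ Irreducible P ∧ P ∣ g := by
    intro P hP
    have h1 := irreducible_of_normalized_factor P hP
    refine ⟨?_, h1, dvd_of_mem_normalizedFactors hP⟩
    rw [← normalize_normalized_factor P hP]
    exact monic_normalize h1.ne_zero
  have h1 : n = ∑ P ∈ T, (normalizedFactors g).count P * P.natDegree := by
    have h2 : (normalizedFactors g).prod = g := by
      rw [prod_normalizedFactors_eq hg0, hg.normalize_eq_self]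
    have h3 := natDegree_multiset_prod_of_monic (normalizedFactors g) (fun P hP => (hnf P hP).1)
    rw [h2, hn, Finset.sum_multiset_map_count] at h3
    rw [h3]
    simp only [smul_eq_mul]
    refine Finset.sum_subset ?_ ?_
    · intro P hP
      have h := hnf P (Multiset.mem_toFinset.1 hP)
      rw [memT]
      exact ⟨h.1, h.2.1, hn ▸ natDegree_le_of_dvd h.2.2 hg0⟩
    · intro P _ hP
      have : P ∉ normalizedFactors g := fun h => hP (Multiset.mem_toFinset.2 h)
      simp [Multiset.count_eq_zero_of_notMem this]
  have h2 : ∀ k ∈ Finset.Icc 1 n, ∑ P ∈ irreduciblesOfDegreeDvd F k,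
      (if P ^ (k / P.natDegree) ∣ g then P.natDegree else 0) =
      ∑ P ∈ T, if P.natDegree ∣ k ∧ P ^ (k / P.natDegree) ∣ g then P.natDegree else 0 := by
    intro k hk
    rw [Finset.mem_Icc] at hk
    have : irreduciblesOfDegreeDvd F k = T.filter (fun P => P.natDegree ∣ k) := by
      ext P
      rw [mem_irreduciblesOfDegreeDvd (by omega), Finset.mem_filter, memT]
      constructor
      · rintro ⟨a, b, c⟩
        exact ⟨⟨a, b, (Nat.le_of_dvd (by omega) c).trans hk.2⟩, c⟩
      · rintro ⟨⟨a, b, _⟩, c⟩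
        exact ⟨a, b, c⟩
    rw [this, Finset.sum_filter]
    refine Finset.sum_congr rfl fun P _ => ?_
    by_cases hd : P.natDegree ∣ k <;> simp [hd]
  rw [Finset.sum_congr rfl h2, Finset.sum_comm]
  conv_lhs => rw [h1]
  refine Finset.sum_congr rfl fun P hP => ?_
  obtain ⟨hPm, hPi, hPd⟩ := (memT P).1 hP
  have hpos := hPi.natDegree_pos
  have hdvd : ∀ j : ℕ, P ^ j ∣ g ↔ j ≤ (normalizedFactors g).count P := by
    intro j
    rw [pow_dvd_iff_le_emultiplicity, emultiplicity_eq_count_normalizedFactors hPi hg0,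
      hPm.normalize_eq_self]
    exact Nat.cast_le
  rw [← Finset.sum_filter, Finset.sum_const, smul_eq_mul]
  congr 1
  have himg : (Finset.Icc 1 n).filter (fun k => P.natDegree ∣ k ∧ P ^ (k / P.natDegree) ∣ g) =
      (Finset.Icc 1 ((normalizedFactors g).count P)).image (fun j => j * P.natDegree) := by
    ext k
    simp only [Finset.mem_filter, Finset.mem_Icc, Finset.mem_image]
    constructor
    · rintro ⟨⟨hk1, hk2⟩, ⟨j, rfl⟩, h⟩
      rw [Nat.mul_div_cancel_left _ hpos, hdvd] at h
      refine ⟨j, ⟨?_, h⟩, mul_comm _ _⟩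
      rcases Nat.eq_zero_or_pos j with rfl | h
      · simp at hk1
      · exact h
    · rintro ⟨j, ⟨hj1, hj2⟩, rfl⟩
      rw [Nat.mul_div_cancel _ hpos]
      have h3 := (hdvd j).2 hj2
      refine ⟨⟨Nat.mul_pos hj1 hpos, ?_⟩, dvd_mul_left _ _, h3⟩
      have := natDegree_le_of_dvd h3 hg0
      rwa [natDegree_pow, hn] at this
  rw [himg, Finset.card_image_of_injective, Nat.card_Icc, Nat.add_sub_cancel]
  intro a b hab
  exact Nat.eq_of_mul_eq_mul_right hpos hab

/-- The logarithmic derivative of the Euler product of a completely multiplicative function on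
monic polynomials, in terms of coefficients. -/
lemma natCast_mul_sum_monicsOfDegree {Λ : F[X] → ℂ} (h1 : Λ 1 = 1)
    (hmul : ∀ f g : F[X], f.Monic → g.Monic → Λ (f * g) = Λ f * Λ g) (n : ℕ) :
    (n : ℂ) * ∑ g ∈ monicsOfDegree F n, Λ g =
      ∑ k ∈ Finset.Icc 1 n,
        (∑ P ∈ irreduciblesOfDegreeDvd F k, P.natDegree * Λ P ^ (k / P.natDegree)) *
          ∑ h ∈ monicsOfDegree F (n - k), Λ h := by
  classical
  have hpow : ∀ P : F[X], P.Monic → ∀ j : ℕ, Λ (P ^ j) = Λ P ^ j := by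
    intro P hP j
    induction j with
    | zero => simp [h1]
    | succ j ih => rw [pow_succ, hmul _ _ (hP.pow j) hP, ih, pow_succ]
  have e1 : (n : ℂ) * ∑ g ∈ monicsOfDegree F n, Λ g =
      ∑ g ∈ monicsOfDegree F n, ∑ k ∈ Finset.Icc 1 n, ∑ P ∈ irreduciblesOfDegreeDvd F k,
        if P ^ (k / P.natDegree) ∣ g then (P.natDegree : ℂ) * Λ g else 0 := by
    rw [Finset.mul_sum]
    refine Finset.sum_congr rfl fun g hg => ?_
    rw [mem_monicsOfDegree] at hg
    have := natDegree_eq_sum_irreducibles hg.1 hg.2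
    have h2 := congrArg (Nat.cast : ℕ → ℂ) this
    rw [h2]
    push_cast
    simp only [Finset.sum_mul, ite_mul, zero_mul]
  rw [e1, Finset.sum_comm]
  refine Finset.sum_congr rfl fun k hk => ?_
  rw [Finset.mem_Icc] at hk
  rw [Finset.sum_comm, Finset.sum_mul]
  refine Finset.sum_congr rfl fun P hP => ?_
  obtain ⟨hPm, hPi, hPd⟩ := (mem_irreduciblesOfDegreeDvd (by omega)).1 hP
  rw [← Finset.sum_filter, mul_assoc, ← Finset.mul_sum]
  congr 1
  rw [← hpow P hPm, Finset.mul_sum]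
  have hQm := hPm.pow (k / P.natDegree)
  have hQd : (P ^ (k / P.natDegree)).natDegree = k := by
    rw [natDegree_pow, Nat.div_mul_cancel hPd]
  symm
  refine Finset.sum_bij (fun h _ => P ^ (k / P.natDegree) * h) ?_ ?_ ?_ ?_
  · intro h hh
    rw [mem_monicsOfDegree] at hh
    rw [Finset.mem_filter, mem_monicsOfDegree]
    refine ⟨⟨hQm.mul hh.1, ?_⟩, dvd_mul_right _ _⟩
    rw [hQm.natDegree_mul hh.1, hQd, hh.2]
    omega
  · intro a _ b _ hab
    exact mul_left_cancel₀ hQm.ne_zero hab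
  · intro g hg
    rw [Finset.mem_filter, mem_monicsOfDegree] at hg
    obtain ⟨⟨hg1, hg2⟩, h, rfl⟩ := hg
    have hh : h.Monic := hQm.of_mul_monic_left hg1
    refine ⟨h, ?_, rfl⟩
    rw [mem_monicsOfDegree]
    refine ⟨hh, ?_⟩
    rw [hQm.natDegree_mul hh, hQd] at hg2
    omega
  · intro h hh
    rw [mem_monicsOfDegree] at hh
    exact (hmul _ _ hQm hh.1).symm

end

section
open Polynomial

lemma finrank_adjoin_simple_eq_div (F : Type*) [Field F] {E : Type*} [Field E] [Algebra F E]
    [FiniteDimensional F E] (x : E) :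
    Module.finrank (IntermediateField.adjoin F {x}) E =
      Module.finrank F E / (minpoly F x).natDegree := by
  have hx : IsIntegral F x := Algebra.IsIntegral.isIntegral x
  rw [← Module.finrank_mul_finrank F (IntermediateField.adjoin F {x}) E,
    IntermediateField.adjoin.finrank hx, Nat.mul_div_cancel_left _ (minpoly.natDegree_pos hx)]

lemma eval_minpoly_pow_eq_norm {F : Type*} [Field F] {E : Type*} [Field E] [Algebra F E]
    [FiniteDimensional F E] (x : E) (r : F) :
    (minpoly F x).eval r ^ (Module.finrank F E / (minpoly F x).natDegree) =
      Algebra.norm F (algebraMap F E r - x) := by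
  have hx : IsIntegral F x := Algebra.IsIntegral.isIntegral x
  set y := x - algebraMap F E r with hy
  have hyi : IsIntegral F y := Algebra.IsIntegral.isIntegral y
  have hmin : minpoly F y = (minpoly F x).comp (X + C r) := minpoly.sub_algebraMap x r
  have hdeg : (minpoly F y).natDegree = (minpoly F x).natDegree := by
    rw [hmin, natDegree_comp, natDegree_X_add_C, mul_one]
  have hc : (minpoly F y).coeff 0 = (minpoly F x).eval r := by
    rw [hmin, coeff_zero_eq_eval_zero, eval_comp]
    simp
  have h1 : Algebra.norm F y = ((-1) ^ (minpoly F x).natDegree * (minpoly F x).eval r) ^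
      (Module.finrank F E / (minpoly F x).natDegree) := by
    rw [Algebra.norm_eq_norm_adjoin F y, finrank_adjoin_simple_eq_div, hdeg]
    congr 1
    rw [← IntermediateField.adjoin.powerBasis_gen hyi,
      Algebra.PowerBasis.norm_gen_eq_coeff_zero_minpoly,
      IntermediateField.adjoin.powerBasis_gen hyi,
      IntermediateField.adjoin.powerBasis_dim, IntermediateField.minpoly_gen, hdeg, hc]
  have h2 : algebraMap F E r - x = algebraMap F E (-1) * y := by
    rw [hy, map_neg, map_one]; ring
  rw [h2, map_mul, h1, Algebra.norm_algebraMap, mul_pow, ← mul_assoc, ← pow_mul,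
    Nat.mul_div_cancel' (minpoly.degree_dvd hx), ← mul_pow]
  simp

lemma nsmul_nextCoeff_minpoly_eq_neg_trace {F : Type*} [Field F] {E : Type*} [Field E] [Algebra F E]
    [FiniteDimensional F E] (x : E) :
    (Module.finrank F E / (minpoly F x).natDegree) • (minpoly F x).nextCoeff =
      -Algebra.trace F E x := by
  rw [trace_eq_finrank_mul_minpoly_nextCoeff, finrank_adjoin_simple_eq_div, nsmul_eq_mul]
  ring

variable {F : Type*} [Field F] [Finite F] (E : Type*) [Field E] [Fintype E] [Algebra F E]

open Classical in
lemma card_filter_minpoly_eq {P : F[X]} (hm : P.Monic) (hi : Irreducible P)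
    (hd : P.natDegree ∣ Module.finrank F E) :
    (Finset.univ.filter fun x : E => minpoly F x = P).card = P.natDegree := by
  have hsplit : (P.map (algebraMap F E)).Splits := by
    have h1 := (hi.natDegree_dvd_iff_dvd_X_pow_card_pow_sub_X).1 hd
    have h2 : Nat.card F ^ Module.finrank F E = Fintype.card E := by
      rw [← Module.natCard_eq_pow_finrank (K := F) (V := E), Nat.card_eq_fintype_card]
    rw [h2] at h1
    have h3 := Polynomial.map_dvd (algebraMap F E) h1
    simp only [Polynomial.map_sub, Polynomial.map_pow, Polynomial.map_X] at h3
    have h4 : (X ^ Fintype.card E - X : E[X]).Splits := by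
      rw [splits_iff_card_roots, FiniteField.roots_X_pow_card_sub_X,
        FiniteField.X_pow_card_sub_X_natDegree_eq E Fintype.one_lt_card]
      rfl
    exact h4.of_dvd (FiniteField.X_pow_card_sub_X_ne_zero E Fintype.one_lt_card) h3
  have hsep : P.Separable := PerfectField.separable_of_irreducible hi
  rw [← card_rootSet_eq_natDegree hsep hsplit, ← Set.toFinset_card]
  congr 1
  ext x
  simp only [Finset.mem_filter, Finset.mem_univ, true_and, Set.mem_toFinset]
  rw [mem_rootSet_of_ne hi.ne_zero]
  constructor
  · rintro rfl
    exact minpoly.aeval F x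
  · intro h
    exact (minpoly.eq_of_irreducible_of_monic hi h hm).symm

lemma sum_irreduciblesOfDegreeDvd_eq (Λ : F[X] → ℂ) :
    ∑ P ∈ irreduciblesOfDegreeDvd F (Module.finrank F E),
      P.natDegree * Λ P ^ (Module.finrank F E / P.natDegree) =
    ∑ x : E, Λ (minpoly F x) ^ (Module.finrank F E / (minpoly F x).natDegree) := by
  classical
  have hk : Module.finrank F E ≠ 0 := Module.finrank_pos.ne'
  rw [← Finset.sum_fiberwise_of_maps_to (s := Finset.univ)
    (t := irreduciblesOfDegreeDvd F (Module.finrank F E)) (g := fun x : E => minpoly F x)]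
  · refine Finset.sum_congr rfl fun P hP => ?_
    obtain ⟨hPm, hPi, hPd⟩ := (mem_irreduciblesOfDegreeDvd hk).1 hP
    rw [Finset.sum_congr rfl (g := fun _ => Λ P ^ (Module.finrank F E / P.natDegree))]
    · rw [Finset.sum_const, card_filter_minpoly_eq E hPm hPi hPd, nsmul_eq_mul]
    · intro x hx
      rw [(Finset.mem_filter.1 hx).2]
  · intro x _
    rw [mem_irreduciblesOfDegreeDvd hk]
    have hx : IsIntegral F x := Algebra.IsIntegral.isIntegral x
    exact ⟨minpoly.monic hx, minpoly.irreducible hx, minpoly.degree_dvd hx⟩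

end

section
open Polynomial

variable {F : Type*} [Field F]

/-- The completely multiplicative function `g ↦ χ(∏ r ∈ R, g(r)) ψ(g.nextCoeff)` on monic
polynomials whose generating series is the L-function of `x ↦ χ(∏ r ∈ R, (r - x)) ψ(-x)`. -/
noncomputable def charWeight (χ : MulChar F ℂ) (ψ : AddChar F ℂ) (R : Finset F) (g : F[X]) : ℂ :=
  χ (∏ r ∈ R, g.eval r) * ψ g.nextCoeff

lemma charWeight_one (χ : MulChar F ℂ) (ψ : AddChar F ℂ) (R : Finset F) :
    charWeight χ ψ R 1 = 1 := by
  have : (1 : F[X]).nextCoeff = 0 := by simp [nextCoeff]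
  simp [charWeight, this]

lemma charWeight_mul (χ : MulChar F ℂ) (ψ : AddChar F ℂ) (R : Finset F) (f g : F[X])
    (hf : f.Monic) (hg : g.Monic) :
    charWeight χ ψ R (f * g) = charWeight χ ψ R f * charWeight χ ψ R g := by
  simp only [charWeight, eval_mul, Finset.prod_mul_distrib, map_mul, hf.nextCoeff_mul hg,
    AddChar.map_add_eq_mul]
  ring

lemma charWeight_minpoly_pow (χ : MulChar F ℂ) (ψ : AddChar F ℂ) (R : Finset F)
    {E : Type*} [Field E] [Finite E] [Algebra F E] (x : E) :
    charWeight χ ψ R (minpoly F x) ^ (Module.finrank F E / (minpoly F x).natDegree) =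
      χ (Algebra.norm F (∏ r ∈ R, (algebraMap F E r - x))) * ψ (-Algebra.trace F E x) := by
  rw [charWeight, mul_pow, ← map_pow, ← Finset.prod_pow,
    map_prod (Algebra.norm F) (fun r => algebraMap F E r - x),
    ← nsmul_nextCoeff_minpoly_eq_neg_trace, AddChar.map_nsmul_eq_pow]
  simp only [eval_minpoly_pow_eq_norm]

variable [Finite F]

lemma sum_monicsOfDegree_charWeight_eq_zero {χ : MulChar F ℂ} (hχ : χ ≠ 1) (ψ : AddChar F ℂ)
    {R : Finset F} (hR : R.Nonempty) {n : ℕ} (hn : R.card < n) :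
    ∑ g ∈ monicsOfDegree F n, charWeight χ ψ R g = 0 := by
  classical
  have := Fintype.ofFinite F
  obtain ⟨r₀, hr₀⟩ := hR
  set h : F[X] := Lagrange.basis R id r₀ with hh
  have hinj : Set.InjOn (id : F → F) R := Function.injective_id.injOn
  have hdeg : h.natDegree + 1 < n := by
    have h1 := Lagrange.degree_basis hinj hr₀
    have h2 : h.natDegree = R.card - 1 := natDegree_eq_of_degree_eq_some h1
    have h3 := Finset.card_pos.2 ⟨r₀, hr₀⟩
    omega
  have heval₀ : h.eval r₀ = 1 := Lagrange.eval_basis_self hinj hr₀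
  have heval : ∀ r ∈ R, r ≠ r₀ → h.eval r = 0 := fun r hr hne =>
    Lagrange.eval_basis_of_ne (v := id) (Ne.symm hne) hr
  have hdt : ∀ t : F, (C t * h).natDegree + 1 < n := fun t =>
    lt_of_le_of_lt (Nat.succ_le_succ (natDegree_C_mul_le t h)) hdeg
  have hmem : ∀ t : F, ∀ g ∈ monicsOfDegree F n, g + C t * h ∈ monicsOfDegree F n := by
    intro t g hg
    rw [mem_monicsOfDegree] at hg ⊢
    have hlt : (C t * h).natDegree < g.natDegree := by have := hdt t; omega
    refine ⟨hg.1.add_of_left (degree_lt_degree hlt), ?_⟩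
    rw [natDegree_add_eq_left_of_natDegree_lt hlt, hg.2]
  have hnext : ∀ t : F, ∀ g ∈ monicsOfDegree F n, (g + C t * h).nextCoeff = g.nextCoeff := by
    intro t g hg
    have h1 := (mem_monicsOfDegree.1 hg).2
    have h2 := (mem_monicsOfDegree.1 (hmem t g hg)).2
    have := hdt t
    rw [nextCoeff_of_natDegree_pos (by omega), nextCoeff_of_natDegree_pos (by omega), h1, h2,
      coeff_add, coeff_eq_zero_of_natDegree_lt (p := C t * h) (by omega), add_zero]
  have hshift : ∀ t : F, ∑ g ∈ monicsOfDegree F n, charWeight χ ψ R (g + C t * h) =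
      ∑ g ∈ monicsOfDegree F n, charWeight χ ψ R g := by
    intro t
    refine Finset.sum_bij' (fun g _ => g + C t * h) (fun g _ => g + C (-t) * h)
      (fun g hg => hmem t g hg) (fun g hg => hmem (-t) g hg) ?_ ?_ ?_
    · intro g _; simp
    · intro g _; simp
    · intro g _; rfl
  have hinner : ∀ g ∈ monicsOfDegree F n, ∑ t : F, charWeight χ ψ R (g + C t * h) = 0 := by
    intro g hg
    have e : ∀ t : F, charWeight χ ψ R (g + C t * h) =
        χ (g.eval r₀ + t) * (χ (∏ r ∈ R.erase r₀, g.eval r) * ψ g.nextCoeff) := by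
      intro t
      rw [charWeight, hnext t g hg, ← Finset.mul_prod_erase R _ hr₀, map_mul, mul_assoc]
      congr 2
      · simp [heval₀]
      · congr 1
        refine Finset.prod_congr rfl fun r hr => ?_
        rw [Finset.mem_erase] at hr
        simp [heval r hr.2 hr.1]
    simp only [e]
    have htr : ∑ t : F, χ (g.eval r₀ + t) = ∑ t, χ t :=
      Equiv.sum_comp (Equiv.addLeft (g.eval r₀)) (fun t => χ t)
    rw [← Finset.sum_mul, htr, MulChar.sum_eq_zero_of_ne_one hχ, zero_mul]
  have htot : (Fintype.card F : ℂ) * ∑ g ∈ monicsOfDegree F n, charWeight χ ψ R g = 0 := by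
    rw [← nsmul_eq_mul, ← Finset.card_univ, ← Finset.sum_const,
      ← Finset.sum_congr rfl (fun t _ => hshift t), Finset.sum_comm]
    exact Finset.sum_eq_zero hinner
  exact (mul_eq_zero.1 htot).resolve_left (Nat.cast_ne_zero.2 Fintype.card_ne_zero)

end

/-- A sequence satisfying Newton's recurrence with finitely supported coefficients is, up to sign,
a sequence of power sums. -/
lemma exists_eq_neg_sum_pow_of_newton {A S : ℕ → ℂ} {d : ℕ} (hA0 : A 0 = 1)
    (hA : ∀ n, d < n → A n = 0)
    (hS : ∀ n : ℕ, (n : ℂ) * A n = ∑ k ∈ Finset.Icc 1 n, S k * A (n - k)) :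
    ∃ w : Fin d → ℂ, ∀ k, 1 ≤ k → S k = -∑ i, w i ^ k := by
  classical
  open Polynomial in
  set Q : ℂ[X] := ∑ n ∈ Finset.range (d + 1), C (A n) * X ^ (d - n) with hQ
  have hcoeff : ∀ n ≤ d, Q.coeff (d - n) = A n := by
    intro n hn
    rw [hQ, Polynomial.finsetSum_coeff, Finset.sum_eq_single n]
    · simp
    · intro m hm hne
      rw [Finset.mem_range] at hm
      rw [Polynomial.coeff_C_mul, Polynomial.coeff_X_pow, if_neg (by omega), mul_zero]
    · intro h
      exact absurd (Finset.mem_range.2 (by omega)) h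
  have hle : Q.natDegree ≤ d := by
    refine Polynomial.natDegree_sum_le_of_forall_le _ _ fun n _ => ?_
    exact (Polynomial.natDegree_C_mul_X_pow_le _ _).trans (Nat.sub_le _ _)
  have hcd : Q.coeff d = 1 := by simpa [hA0] using hcoeff 0 (Nat.zero_le _)
  have hdeg : Q.natDegree = d :=
    le_antisymm hle (Polynomial.le_natDegree_of_ne_zero (by rw [hcd]; exact one_ne_zero))
  have hmonic : Q.Monic := by rw [Polynomial.Monic, Polynomial.leadingCoeff, hdeg, hcd]
  have hsplit : Q.Splits := IsAlgClosed.splits Q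
  have hcard : Multiset.card Q.roots = d := by rw [← hsplit.natDegree_eq_card_roots, hdeg]
  have hprod : (Q.roots.map fun a => Polynomial.X - Polynomial.C a).prod = Q :=
    (hsplit.eq_prod_roots_of_monic hmonic).symm
  obtain ⟨w, hw⟩ : ∃ w : Fin d → ℂ, Finset.univ.val.map w = Q.roots := by
    have hlen : Q.roots.toList.length = d := by rw [Multiset.length_toList, hcard]
    refine ⟨fun i => Q.roots.toList.get (i.cast hlen.symm), ?_⟩
    conv_rhs => rw [← Multiset.coe_toList Q.roots]
    rw [Fin.univ_val_map]
    refine congrArg _ (List.ext_get (by simp [hlen]) fun n h1 h2 => by simp)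
  refine ⟨w, ?_⟩
  set e : ℕ → ℂ := fun n => MvPolynomial.aeval w (MvPolynomial.esymm (Fin d) ℂ n) with he
  have hAe : ∀ n, A n = (-1) ^ n * e n := by
    intro n
    rw [he]
    simp only [MvPolynomial.aeval_esymm_eq_multiset_esymm, hw]
    rcases le_or_gt n d with hn | hn
    · rw [← hcoeff n hn, ← hprod, Multiset.prod_X_sub_C_coeff _ (by omega), hcard, hprod,
        Nat.sub_sub_self hn]
    · rw [hA n hn, Multiset.esymm, Multiset.powersetCard_eq_empty _ (by omega)]
      simp
  have hnewton : ∀ k : ℕ, (k : ℂ) * A k =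
      ∑ j ∈ Finset.Icc 1 k, (-∑ i, w i ^ j) * A (k - j) := by
    intro k
    have h1 := congrArg (MvPolynomial.aeval w) (MvPolynomial.mul_esymm_eq_sum (Fin d) ℂ k)
    simp only [map_mul, map_natCast, map_pow, map_neg, map_one, map_sum,
      MvPolynomial.psum, MvPolynomial.aeval_X] at h1
    change (k : ℂ) * e k = _ at h1
    rw [hAe k, mul_left_comm, h1, ← mul_assoc, ← pow_add,
      Odd.neg_one_pow (by exact ⟨k, by ring⟩), neg_one_mul, ← Finset.sum_neg_distrib]
    refine Finset.sum_bij' (fun a _ => a.2) (fun j _ => (k - j, j)) ?_ ?_ ?_ ?_ ?_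
    · intro a ha
      simp only [Finset.mem_filter, Finset.HasAntidiagonal.mem_antidiagonal] at ha
      rw [Finset.mem_Icc]; omega
    · intro j hj
      rw [Finset.mem_Icc] at hj
      simp only [Finset.mem_filter, Finset.HasAntidiagonal.mem_antidiagonal]; omega
    · intro a ha
      simp only [Finset.mem_filter, Finset.HasAntidiagonal.mem_antidiagonal] at ha
      ext <;> simp; omega
    · intro j hj; rfl
    · intro a ha
      simp only [Finset.mem_filter, Finset.HasAntidiagonal.mem_antidiagonal] at ha
      have h2 : k - a.2 = a.1 := by omega
      rw [h2, hAe a.1]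
      simp only [he]
      ring
  intro k
  induction k using Nat.strong_induction_on with
  | _ k ih =>
    intro hk
    have h1 := (hS k).symm.trans (hnewton k)
    have hmem : k ∈ Finset.Icc 1 k := Finset.mem_Icc.2 ⟨hk, le_rfl⟩
    rw [← Finset.sum_erase_add _ _ hmem, ← Finset.sum_erase_add _ _ hmem,
      Finset.sum_congr rfl (g := fun j => (-∑ i, w i ^ j) * A (k - j))] at h1
    · simpa [hA0] using add_left_cancel h1
    · intro j hj
      rw [Finset.mem_erase, Finset.mem_Icc] at hj
      rw [ih j (by omega) hj.2.1]

section
open Polynomial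

lemma sum_C_mul_X_pow_mul_ne_zero {E ι : Type*} [Field E] [Fintype ι] {o : ι → ℕ}
    (ho : Function.Injective o) {G : ι → E[X]} (hG : ∀ i, (G i).coeff 0 ≠ 0) {c : ι → E}
    (hc : c ≠ 0) : ∑ i, C (c i) * (X ^ o i * G i) ≠ 0 := by
  classical
  obtain ⟨i₁, hi₁⟩ := Function.ne_iff.1 hc
  obtain ⟨i₀, hi₀, hmin⟩ := Finset.exists_min_image (Finset.univ.filter fun i => c i ≠ 0) o
    ⟨i₁, by simpa using hi₁⟩
  rw [Finset.mem_filter] at hi₀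
  intro h
  have h1 := congrArg (fun P : E[X] => P.coeff (o i₀)) h
  simp only [finsetSum_coeff, coeff_C_mul, coeff_X_pow_mul', coeff_zero] at h1
  rw [Finset.sum_eq_single i₀] at h1
  · simp only [le_refl, if_true, Nat.sub_self] at h1
    exact mul_ne_zero hi₀.2 (hG i₀) h1
  · intro i _ hne
    by_cases hci : c i = 0
    · rw [hci, zero_mul]
    · have h2 := hmin i (by simpa using hci)
      have h3 : o i₀ ≠ o i := fun h => hne (ho h.symm)
      rw [if_neg (by omega), mul_zero]
  · simp

lemma exists_ne_zero_sum_smul_eq_zero {E ι : Type*} [Field E] [Fintype ι] (P : ι → E[X]) {T : ℕ}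
    (hP : ∀ i, (P i).natDegree < T) (hT : T < Fintype.card ι) :
    ∃ b : ι → E, b ≠ 0 ∧ ∑ i, C (b i) * P i = 0 := by
  let L : (ι → E) →ₗ[E] (Fin T → E) :=
    { toFun := fun b t => ∑ i, b i * (P i).coeff t
      map_add' := by intro b b'; ext t; simp [add_mul, Finset.sum_add_distrib]
      map_smul' := by intro r b; ext t; simp [Finset.mul_sum, mul_assoc] }
  have hker : LinearMap.ker L ≠ ⊥ := by
    apply LinearMap.ker_ne_bot_of_finrank_lt
    simpa using hT
  obtain ⟨b, hb, hb0⟩ := Submodule.exists_mem_ne_zero_of_ne_bot hker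
  refine ⟨b, hb0, ?_⟩
  ext t
  rw [coeff_zero, finsetSum_coeff]
  simp only [coeff_C_mul]
  by_cases ht : t < T
  · exact congrFun (LinearMap.mem_ker.1 hb) ⟨t, ht⟩
  · refine Finset.sum_eq_zero fun i _ => ?_
    rw [coeff_eq_zero_of_natDegree_lt (by have := hP i; omega), mul_zero]

/-- Stepanov's method for the fibres of `z ↦ f(z) ^ ((q - 1) / m)` over a field with `q = M ^ 2`
elements, where `m` divides `M - 1`. -/
lemma card_filter_eval_pow_eq_le {E : Type*} [Field E] [Fintype E] [DecidableEq E] {p ν m e : ℕ}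
    [Fact p.Prime] [CharP E p] (hcard : Fintype.card E = (p ^ ν) ^ 2) (hM : 3 ≤ p ^ ν)
    (hm : 2 ≤ m) (hme : m * e + 1 = p ^ ν) {f₁ : E[X]} (hf₁ : f₁.coeff 0 ≠ 0) {a : E}
    (ha : a ≠ 0) :
    (Finset.univ.filter fun z : E => (X * f₁).eval z ^ (e * (p ^ ν + 1)) = a).card ≤
      e * (p ^ ν + 1) + p ^ ν * (3 * (X * f₁).natDegree + 2) := by
  set M := p ^ ν with hMdef
  set f : E[X] := X * f₁ with hf
  set D := f.natDegree with hD
  set J := e + 2 * D + 2 with hJ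
  let P : Fin J × Fin m × Fin e → E[X] := fun t =>
    C (a ^ (t.2.1 : ℕ)) * (X ^ ((t.2.2 : ℕ) * M + t.1) * f ^ ((m - t.2.1) * e))
  have hPdeg : ∀ t, (P t).natDegree < (e - 1) * M + J + m * e * D := by
    rintro ⟨j, i, k⟩
    have h1 : (P (j, i, k)).natDegree ≤ ((k : ℕ) * M + j) + ((m - i) * e) * D := by
      refine (natDegree_C_mul_le _ _).trans (natDegree_mul_le.trans ?_)
      exact Nat.add_le_add (natDegree_X_pow_le _) natDegree_pow_le
    have h2 : (k : ℕ) * M ≤ (e - 1) * M := Nat.mul_le_mul_right _ (by have := k.2; omega)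
    have h3 : ((m - (i : ℕ)) * e) * D ≤ m * e * D :=
      Nat.mul_le_mul_right _ (Nat.mul_le_mul_right _ (Nat.sub_le _ _))
    have := j.2
    omega
  have hcount : (e - 1) * M + J + m * e * D < Fintype.card (Fin J × Fin m × Fin e) := by
    simp only [Fintype.card_prod, Fintype.card_fin]
    have he : 1 ≤ e := by
      rcases Nat.eq_zero_or_pos e with h | h
      · rw [h] at hme; omega
      · exact h
    obtain ⟨e', rfl⟩ : ∃ e', e = e' + 1 := ⟨e - 1, by omega⟩
    obtain ⟨m', rfl⟩ : ∃ m', m = m' + 2 := ⟨m - 2, by omega⟩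
    rw [Nat.add_sub_cancel, ← hme, hJ]
    ring_nf
    nlinarith [Nat.zero_le (m' * e'), Nat.zero_le (m' * D), Nat.zero_le (e' * D),
      Nat.zero_le (m' * e' * D), Nat.zero_le (m' * e' * e')]
  obtain ⟨b, hb0, hb⟩ := exists_ne_zero_sum_smul_eq_zero P hPdeg hcount
  have hMM : ∀ x : E, (x ^ M) ^ M = x := by
    intro x
    rw [← pow_mul, ← sq, ← hcard, FiniteField.pow_card]
  set s : E[X] := ∑ t : Fin J × Fin m × Fin e,
    C (b t ^ M) * (X ^ ((t.2.2 : ℕ) + t.2.1 * e + M * t.1) * f₁ ^ ((t.2.1 : ℕ) * e)) with hs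
  have hlt : ∀ (i : Fin m) (k : Fin e), (k : ℕ) + i * e < M := by
    intro i k
    have h1 : ((i : ℕ) + 1) * e ≤ m * e := Nat.mul_le_mul_right _ i.2
    have := k.2
    rw [add_mul] at h1
    omega
  have hinj : Function.Injective fun t : Fin J × Fin m × Fin e =>
      (t.2.2 : ℕ) + t.2.1 * e + M * t.1 := by
    rintro ⟨j, i, k⟩ ⟨j', i', k'⟩ h
    simp only at h
    have hM0 : 0 < M := by omega
    have h1 := congrArg (· / M) h
    have h2 := congrArg (· % M) h
    simp only [Nat.add_mul_div_left _ _ hM0, Nat.div_eq_of_lt (hlt _ _), zero_add] at h1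
    simp only [Nat.add_mul_mod_self_left, Nat.mod_eq_of_lt (hlt _ _)] at h2
    have he0 : 0 < e := lt_of_le_of_lt (Nat.zero_le _) k.2
    have h3 := congrArg (· / e) h2
    have h4 := congrArg (· % e) h2
    simp only [Nat.add_mul_div_right _ _ he0, Nat.div_eq_of_lt k.2, Nat.div_eq_of_lt k'.2,
      zero_add] at h3
    simp only [Nat.add_mul_mod_self_right, Nat.mod_eq_of_lt k.2, Nat.mod_eq_of_lt k'.2] at h4
    simp only [Prod.mk.injEq, Fin.ext_iff]
    exact ⟨h1, h3, h4⟩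
  have hs0 : s ≠ 0 := by
    refine sum_C_mul_X_pow_mul_ne_zero hinj (fun t => ?_) ?_
    · rw [coeff_zero_eq_eval_zero, eval_pow]
      rw [coeff_zero_eq_eval_zero] at hf₁
      exact pow_ne_zero _ hf₁
    · intro h
      refine hb0 (funext fun t => ?_)
      have h1 := congrFun h t
      exact pow_eq_zero_iff (by omega : M ≠ 0) |>.1 h1
  have hsdeg : s.natDegree ≤ e * (M + 1) + M * (3 * D + 2) := by
    refine natDegree_sum_le_of_forall_le _ _ ?_
    rintro ⟨j, i, k⟩ -
    have h0 : X ^ ((k : ℕ) + i * e + M * j) * f₁ ^ ((i : ℕ) * e) =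
        X ^ ((k : ℕ) + M * j) * f ^ ((i : ℕ) * e) := by
      rw [hf, mul_pow]; ring
    refine (natDegree_C_mul_le _ _).trans ?_
    simp only
    rw [h0]
    have h1 : (X ^ ((k : ℕ) + M * j) * f ^ ((i : ℕ) * e)).natDegree ≤
        ((k : ℕ) + M * j) + ((i : ℕ) * e) * D :=
      natDegree_mul_le.trans (Nat.add_le_add (natDegree_X_pow_le _) natDegree_pow_le)
    have h2 : M * (j : ℕ) ≤ M * J := Nat.mul_le_mul_left _ j.2.le
    have h3 : ((i : ℕ) * e) * D ≤ M * D := Nat.mul_le_mul_right _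
      ((Nat.mul_le_mul_right e i.2.le).trans (by omega))
    have := k.2
    have h4 : M * J = M * e + 2 * (M * D) + 2 * M := by rw [hJ]; ring
    have h5 : e * (M + 1) + M * (3 * D + 2) = e + M * e + 3 * (M * D) + 2 * M := by ring
    omega
  refine le_trans ?_ hsdeg
  refine le_trans (Finset.card_le_card ?_) ((Multiset.toFinset_card_le s.roots).trans
    (card_roots' s))
  intro x hx
  rw [Finset.mem_filter] at hx
  rw [Multiset.mem_toFinset, mem_roots hs0, IsRoot.def]
  have hfx : f.eval x ≠ 0 := by
    intro h
    rw [h, zero_pow] at hx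
    · exact ha hx.2.symm
    · intro h0
      rw [h0, pow_zero] at hx
      have : e = 0 := by
        rcases Nat.mul_eq_zero.1 h0 with h | h
        · exact h
        · omega
      rw [this] at hme
      omega
  have hxM : x ^ (M * M) = x := by rw [pow_mul, hMM]
  have key : f.eval x ^ (m * e) * (s.eval x) ^ M = 0 := by
    have h1 : (s.eval x) ^ M = ∑ t : Fin J × Fin m × Fin e,
        b t * (x ^ ((t.2.2 : ℕ) * M + t.1) * f.eval x ^ ((t.2.1 : ℕ) * e * M)) := by
      rw [hs, eval_finsetSum, hMdef, sum_pow_char_pow, ← hMdef]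
      refine Finset.sum_congr rfl fun t _ => ?_
      rw [eval_mul, eval_C, mul_pow, hMM, eval_mul, eval_pow, eval_pow, eval_X, mul_pow]
      congr 1
      have h2 : x ^ (M * (t.1 : ℕ) * M) = x ^ (t.1 : ℕ) := by
        rw [mul_right_comm, pow_mul, hxM]
      have h3 : f.eval x = x * f₁.eval x := by rw [hf, eval_mul, eval_X]
      rw [h3, ← pow_mul, ← pow_mul, add_mul, pow_add, h2]
      ring
    have h2 := congrArg (eval x) hb
    rw [eval_zero, eval_finsetSum] at h2
    rw [h1, Finset.mul_sum, ← h2]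
    refine Finset.sum_congr rfl fun t _ => ?_
    have hi := t.2.1.2
    obtain ⟨d, hd⟩ : ∃ d, m = t.2.1 + d := ⟨m - t.2.1, by omega⟩
    simp only [P, eval_mul, eval_C, eval_pow, eval_X]
    rw [show m - (t.2.1 : ℕ) = d by omega, ← hx.2,
      show m * e = t.2.1 * e + d * e by rw [← add_mul, ← hd]]
    ring
  rcases mul_eq_zero.1 key with h | h
  · exact absurd h (pow_ne_zero _ hfx)
  · exact pow_eq_zero_iff (by omega : M ≠ 0) |>.1 h
end

section
open Polynomial

lemma norm_sum_mulChar_norm_eval_le {p ν : ℕ} [Fact p.Prime] (hp : 3 ≤ p) (hν : ν ≠ 0)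
    {E : Type*} [Field E] [Fintype E] [Algebra (ZMod p) E]
    (hcard : Fintype.card E = (p ^ ν) ^ 2) {χ : MulChar (ZMod p) ℂ} (hχ : χ ≠ 1) {f₁ : E[X]}
    (hf₁ : f₁.coeff 0 ≠ 0) :
    ‖∑ z : E, χ (Algebra.norm (ZMod p) ((X * f₁).eval z))‖ ≤
      p * (4 * (X * f₁).natDegree + 3) * p ^ ν := by
  classical
  have : CharP E p := charP_of_injective_algebraMap (algebraMap (ZMod p) E).injective p
  set f : E[X] := X * f₁ with hf
  set D := f.natDegree with hD
  have hM : 3 ≤ p ^ ν := hp.trans (Nat.le_self_pow hν p)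
  obtain ⟨e, he⟩ : p - 1 ∣ p ^ ν - 1 := Nat.sub_one_dvd_pow_sub_one p ν
  have hme : (p - 1) * e + 1 = p ^ ν := by omega
  set M := p ^ ν with hMdef
  have hexp : (M ^ 2 - 1) / (p - 1) = e * (M + 1) := by
    have : M ^ 2 - 1 = (p - 1) * (e * (M + 1)) := by
      rw [← mul_assoc, ← he, mul_comm, ← Nat.sq_sub_sq, one_pow]
    rw [this, Nat.mul_div_cancel_left _ (by omega)]
  have hnorm : ∀ y : E, algebraMap (ZMod p) E (Algebra.norm (ZMod p) y) = y ^ (e * (M + 1)) := by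
    intro y
    rw [FiniteField.algebraMap_norm_eq_pow, Nat.card_eq_fintype_card, Nat.card_eq_fintype_card,
      ZMod.card, hcard, hexp]
  let N : ZMod p → ℕ := fun a =>
    (Finset.univ.filter fun z : E => Algebra.norm (ZMod p) (f.eval z) = a).card
  have hN : ∀ a, a ≠ 0 → N a ≤ e * (M + 1) + M * (3 * D + 2) := by
    intro a ha
    have h1 := card_filter_eval_pow_eq_le (E := E) hcard hM (by omega : 2 ≤ p - 1) hme hf₁
      ((map_ne_zero (algebraMap (ZMod p) E)).2 ha)
    convert h1 using 3 with z
    rw [← hMdef, ← hnorm, (algebraMap (ZMod p) E).injective.eq_iff]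
  set B : ℕ := e * (M + 1) + M * (3 * D + 2) with hB
  have hsum : ∑ z : E, χ (Algebra.norm (ZMod p) (f.eval z)) =
      ∑ a ∈ Finset.univ.erase (0 : ZMod p), χ a * N a := by
    rw [← Finset.sum_fiberwise (s := Finset.univ) (g := fun z => Algebra.norm (ZMod p) (f.eval z)),
      ← Finset.sum_erase_add _ _ (Finset.mem_univ (0 : ZMod p))]
    have h0 : ∀ a : ZMod p, ∑ z : E with Algebra.norm (ZMod p) (f.eval z) = a,
        χ (Algebra.norm (ZMod p) (f.eval z)) = χ a * N a := by
      intro a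
      rw [Finset.sum_congr rfl (g := fun _ => χ a), Finset.sum_const, nsmul_eq_mul, mul_comm]
      intro z hz
      rw [(Finset.mem_filter.1 hz).2]
    simp only [h0, MulChar.map_zero, zero_mul, add_zero]
  have htot : M ^ 2 ≤ ∑ a ∈ Finset.univ.erase (0 : ZMod p), N a + D := by
    have h1 : ∑ a : ZMod p, N a = M ^ 2 := by
      rw [← hcard, ← Finset.card_univ]
      exact (Finset.card_eq_sum_card_fiberwise fun _ _ => Finset.mem_univ _).symm
    have hf0 : f ≠ 0 := mul_ne_zero X_ne_zero (by rintro rfl; simp at hf₁)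
    have h2 : N 0 ≤ D := by
      refine le_trans (Finset.card_le_card ?_) ((Multiset.toFinset_card_le f.roots).trans
        (card_roots' f))
      intro z hz
      rw [Finset.mem_filter, Algebra.norm_eq_zero_iff] at hz
      rw [Multiset.mem_toFinset, mem_roots hf0, IsRoot.def]
      exact hz.2
    rw [← h1, ← Finset.sum_erase_add _ _ (Finset.mem_univ (0 : ZMod p))]
    omega
  have hχ0 : ∑ a ∈ Finset.univ.erase (0 : ZMod p), χ a = 0 := by
    rw [← MulChar.sum_eq_zero_of_ne_one hχ,
      ← Finset.sum_erase_add _ _ (Finset.mem_univ (0 : ZMod p)), MulChar.map_zero, add_zero]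
  have hflip : ∑ z : E, χ (Algebra.norm (ZMod p) (f.eval z)) =
      -∑ a ∈ Finset.univ.erase (0 : ZMod p), χ a * ((B : ℂ) - N a) := by
    rw [hsum]
    simp only [mul_sub, Finset.sum_sub_distrib, ← Finset.sum_mul, hχ0]
    ring
  have hle : ‖∑ z : E, χ (Algebra.norm (ZMod p) (f.eval z))‖ ≤
      ∑ a ∈ Finset.univ.erase (0 : ZMod p), ((B : ℝ) - N a) := by
    rw [hflip, norm_neg]
    refine (norm_sum_le _ _).trans (Finset.sum_le_sum fun a ha => ?_)
    have h1 : (N a : ℝ) ≤ B := by exact_mod_cast hN a (Finset.ne_of_mem_erase ha)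
    have h2 : ‖((B : ℂ) - N a)‖ = (B : ℝ) - N a := by
      rw [show ((B : ℂ) - N a) = (((B : ℝ) - N a : ℝ) : ℂ) by push_cast; rfl, Complex.norm_real,
        Real.norm_of_nonneg (by linarith)]
    rw [norm_mul, h2]
    exact mul_le_of_le_one_left (by linarith) (DirichletCharacter.norm_le_one χ a)
  refine hle.trans ?_
  rw [Finset.sum_sub_distrib, Finset.sum_const, Finset.card_erase_of_mem (Finset.mem_univ _),
    Finset.card_univ, ZMod.card, nsmul_eq_mul]
  have h3 : ((p - 1 : ℕ) : ℝ) * B + D ≤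
      (p * (4 * D + 3) * M : ℝ) + M ^ 2 := by
    have h4 : (p - 1) * B + D ≤ p * (4 * D + 3) * M + M ^ 2 := by
      have h5 : (p - 1) * B = M ^ 2 - 1 + (p - 1) * (M * (3 * D + 2)) := by
        rw [hB, mul_add, ← mul_assoc, ← he, mul_comm (M - 1), ← Nat.sq_sub_sq, one_pow]
      have h6 : (p - 1) * (M * (3 * D + 2)) ≤ p * (M * (3 * D + 2)) :=
        Nat.mul_le_mul_right _ (Nat.sub_le _ _)
      have h7 : D ≤ p * M * (D + 1) :=
        (Nat.le_succ D).trans (Nat.le_mul_of_pos_left _ (Nat.mul_pos (by omega) (by omega)))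
      have h8 : p * (4 * D + 3) * M = p * (M * (3 * D + 2)) + p * M * (D + 1) := by ring
      have h9 := Nat.sub_le (M ^ 2) 1
      omega
    exact_mod_cast h4
  have h5 : (M : ℝ) ^ 2 ≤ ∑ a ∈ Finset.univ.erase (0 : ZMod p), (N a : ℝ) + D := by
    exact_mod_cast htot
  have h6 : (M : ℝ) = (p : ℝ) ^ ν := by rw [hMdef]; push_cast; rfl
  rw [← h6]
  linarith
end

lemma norm_le_of_norm_sum_pow_le {ι : Type*} [Fintype ι] {w : ι → ℂ} {B R : ℝ} {k₀ : ℕ}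
    (hR : 0 < R) (h : ∀ k, k₀ ≤ k → ‖∑ i, w i ^ k‖ ≤ B * R ^ k) (i : ι) : ‖w i‖ ≤ R := by
  classical
  by_contra! hlt
  open Polynomial in
  set Q : ℂ[X] := ∏ v ∈ (Finset.univ.image w).erase (w i), (X - C v) with hQ
  have hQ0 : Q.eval (w i) ≠ 0 := by
    rw [hQ, Polynomial.eval_prod]
    refine Finset.prod_ne_zero_iff.2 fun v hv => ?_
    simpa [sub_ne_zero] using (Finset.ne_of_mem_erase hv).symm
  have hQj : ∀ j, w j ≠ w i → Q.eval (w j) = 0 := by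
    intro j hj
    rw [hQ, Polynomial.eval_prod]
    refine Finset.prod_eq_zero (Finset.mem_erase.2
      ⟨hj, Finset.mem_image_of_mem w (Finset.mem_univ j)⟩) ?_
    simp
  have hid : ∀ k, ∑ j, Q.eval (w j) * w j ^ k =
      ((Finset.univ.filter fun j => w j = w i).card : ℂ) * (Q.eval (w i) * w i ^ k) := by
    intro k
    rw [← nsmul_eq_mul, ← Finset.sum_const, Finset.sum_filter]
    refine Finset.sum_congr rfl fun j _ => ?_
    split_ifs with hj
    · rw [hj]
    · rw [hQj j hj, zero_mul]
  set B' : ℝ := ∑ t ∈ Finset.range (Q.natDegree + 1), ‖Q.coeff t‖ * (B * R ^ t) with hB'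
  have hup : ∀ k, k₀ ≤ k → ‖∑ j, Q.eval (w j) * w j ^ k‖ ≤ B' * R ^ k := by
    intro k hk
    have h1 : ∑ j, Q.eval (w j) * w j ^ k =
        ∑ t ∈ Finset.range (Q.natDegree + 1), Q.coeff t * ∑ j, w j ^ (k + t) := by
      simp only [Polynomial.eval_eq_sum_range, Finset.sum_mul, Finset.mul_sum]
      rw [Finset.sum_comm]
      refine Finset.sum_congr rfl fun t _ => Finset.sum_congr rfl fun j _ => ?_
      ring
    rw [h1, hB', Finset.sum_mul]
    refine (norm_sum_le _ _).trans (Finset.sum_le_sum fun t _ => ?_)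
    rw [norm_mul, mul_assoc, mul_assoc, ← pow_add, add_comm t k]
    exact mul_le_mul_of_nonneg_left (h _ (by omega)) (norm_nonneg _)
  have hcard : 1 ≤ (Finset.univ.filter fun j => w j = w i).card :=
    Finset.card_pos.2 ⟨i, by simp⟩
  have hlow : ∀ k, k₀ ≤ k → ‖Q.eval (w i)‖ * ‖w i‖ ^ k ≤ B' * R ^ k := by
    intro k hk
    refine le_trans ?_ (hup k hk)
    rw [hid, norm_mul, norm_mul, norm_pow, Complex.norm_natCast]
    refine le_mul_of_one_le_left (by positivity) ?_
    exact_mod_cast hcard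
  have hratio : 1 < ‖w i‖ / R := (one_lt_div hR).2 hlt
  obtain ⟨n, hn⟩ := pow_unbounded_of_one_lt (B' / ‖Q.eval (w i)‖) hratio
  have hpos : 0 < ‖Q.eval (w i)‖ := norm_pos_iff.2 hQ0
  have h2 := hlow (max n k₀) (le_max_right _ _)
  have h3 : (‖w i‖ / R) ^ n ≤ (‖w i‖ / R) ^ (max n k₀) :=
    pow_le_pow_right₀ hratio.le (le_max_left _ _)
  have h4 : (‖w i‖ / R) ^ (max n k₀) ≤ B' / ‖Q.eval (w i)‖ := by
    rw [div_pow, div_le_div_iff₀ (by positivity) hpos]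
    linarith
  linarith

section

variable {K E : Type*} [Field K] [Fintype K] [Field E] [Algebra K E]

lemma pow_card_eq_self_iff (z : E) :
    z ^ Fintype.card K = z ↔ ∃ a : K, algebraMap K E a = z := by
  classical
  constructor
  · intro hz
    by_contra! hne
    have h0 := FiniteField.X_pow_card_sub_X_ne_zero E (Fintype.one_lt_card (α := K))
    have h1 : insert z (Finset.univ.image (algebraMap K E)) ⊆
        (Polynomial.X ^ Fintype.card K - Polynomial.X : Polynomial E).roots.toFinset := by
      intro y hy
      rw [Multiset.mem_toFinset, Polynomial.mem_roots h0, Polynomial.IsRoot.def]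
      rcases Finset.mem_insert.1 hy with rfl | hy
      · simp [hz]
      · obtain ⟨a, -, rfl⟩ := Finset.mem_image.1 hy
        simp [← map_pow, FiniteField.pow_card]
    have h2 := (Finset.card_le_card h1).trans ((Multiset.toFinset_card_le _).trans
      (Polynomial.card_roots' _))
    rw [FiniteField.X_pow_card_sub_X_natDegree_eq E Fintype.one_lt_card,
      Finset.card_insert_of_notMem (by simpa using hne),
      Finset.card_image_of_injective _ (algebraMap K E).injective, Finset.card_univ] at h2
    omega
  · rintro ⟨a, rfl⟩
    rw [← map_pow, FiniteField.pow_card]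

variable (K E) in
/-- The Artin–Schreier map `z ↦ z ^ #K - z`. -/
noncomputable def artinSchreier : E →ₗ[K] E :=
  (FiniteField.frobeniusAlgHom K E).toLinearMap - LinearMap.id

lemma artinSchreier_apply (z : E) : artinSchreier K E z = z ^ Fintype.card K - z := rfl

lemma ker_artinSchreier :
    LinearMap.ker (artinSchreier K E) = LinearMap.range (Algebra.linearMap K E) := by
  ext z
  rw [LinearMap.mem_ker, artinSchreier_apply, sub_eq_zero, pow_card_eq_self_iff]
  rfl

variable [Fintype E]

/-- Additive form of Hilbert's Theorem 90 for finite fields. -/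
lemma range_artinSchreier :
    LinearMap.range (artinSchreier K E) = LinearMap.ker (Algebra.trace K E) := by
  refine Submodule.eq_of_le_of_finrank_eq ?_ ?_
  · rintro _ ⟨z, rfl⟩
    rw [LinearMap.mem_ker, artinSchreier_apply, map_sub, sub_eq_zero]
    exact Algebra.trace_eq_of_algEquiv (FiniteField.frobeniusAlgEquivOfAlgebraic K E) z
  · have h1 := (artinSchreier K E).finrank_range_add_finrank_ker
    have h2 := (Algebra.trace K E).finrank_range_add_finrank_ker
    rw [ker_artinSchreier, LinearMap.finrank_range_of_inj (f := Algebra.linearMap K E)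
      (algebraMap K E).injective, Module.finrank_self] at h1
    rw [LinearMap.range_eq_top.2 (Algebra.trace_surjective K E), finrank_top,
      Module.finrank_self] at h2
    omega

lemma card_filter_pow_card_sub_eq [DecidableEq E] [DecidableEq K] (x : E) :
    (Finset.univ.filter fun z : E => z ^ Fintype.card K - z = x).card =
      if Algebra.trace K E x = 0 then Fintype.card K else 0 := by
  split_ifs with h
  · obtain ⟨z₀, hz₀⟩ : x ∈ LinearMap.range (artinSchreier K E) := by
      rw [range_artinSchreier]; exact h
    have himg : (Finset.univ.filter fun z : E => z ^ Fintype.card K - z = x) =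
        Finset.univ.image fun a : K => z₀ + algebraMap K E a := by
      ext z
      rw [Finset.mem_filter, Finset.mem_image, ← artinSchreier_apply, ← hz₀, ← sub_eq_zero,
        ← map_sub, artinSchreier_apply, sub_eq_zero, pow_card_eq_self_iff]
      simp only [Finset.mem_univ, true_and]
      refine exists_congr fun a => ?_
      rw [eq_sub_iff_add_eq, add_comm]
    rw [himg, Finset.card_image_of_injective _ fun a b hab =>
      (algebraMap K E).injective (add_left_cancel hab), Finset.card_univ]
  · rw [Finset.card_eq_zero, Finset.filter_eq_empty_iff]
    intro z _ hz
    refine h ?_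
    rw [← LinearMap.mem_ker, ← range_artinSchreier]
    exact ⟨z, hz⟩

lemma sum_addChar_sum_mul_trace_eq (g : E → ℂ) :
    ∑ ψ : AddChar K ℂ, ∑ x : E, g x * ψ (-Algebra.trace K E x) =
      ∑ z : E, g (z ^ Fintype.card K - z) := by
  classical
  have h : ∀ x : E, ∑ z : E with z ^ Fintype.card K - z = x, g (z ^ Fintype.card K - z) =
      ∑ ψ : AddChar K ℂ, g x * ψ (-Algebra.trace K E x) := by
    intro x
    rw [← Finset.mul_sum, AddChar.sum_apply_eq_ite, Finset.sum_congr rfl (g := fun _ => g x),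
      Finset.sum_const, card_filter_pow_card_sub_eq (K := K) x, nsmul_eq_mul, mul_comm]
    · simp
    · intro z hz
      rw [(Finset.mem_filter.1 hz).2]
  rw [Finset.sum_comm, ← Finset.sum_congr rfl fun x _ => h x]
  exact Finset.sum_fiberwise _ (fun z : E => z ^ Fintype.card K - z) _

end

section
open Polynomial

/-- The mixed character sums over the finite extensions of a finite field are power sums. -/
lemma exists_sum_mulChar_norm_mul_addChar_trace_eq {F : Type} [Field F] [Finite F]
    {χ : MulChar F ℂ} (hχ : χ ≠ 1) (ψ : AddChar F ℂ) {R : Finset F} (hR : R.Nonempty) :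
    ∃ w : Fin R.card → ℂ, ∀ (E : Type) [Field E] [Fintype E] [Algebra F E],
      ∑ x : E, χ (Algebra.norm F (∏ r ∈ R, (algebraMap F E r - x))) *
        ψ (-Algebra.trace F E x) = -∑ i, w i ^ Module.finrank F E := by
  obtain ⟨w, hw⟩ := exists_eq_neg_sum_pow_of_newton (d := R.card)
    (A := fun n => ∑ g ∈ monicsOfDegree F n, charWeight χ ψ R g)
    (S := fun k => ∑ P ∈ irreduciblesOfDegreeDvd F k,
      P.natDegree * charWeight χ ψ R P ^ (k / P.natDegree))
    (by
      have : monicsOfDegree F 0 = {1} := by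
        ext g
        rw [mem_monicsOfDegree, Finset.mem_singleton]
        exact ⟨fun h => h.1.natDegree_eq_zero.1 h.2, by rintro rfl; simp⟩
      simp only [this, Finset.sum_singleton, charWeight_one])
    (fun n hn => sum_monicsOfDegree_charWeight_eq_zero hχ ψ hR hn)
    (natCast_mul_sum_monicsOfDegree (charWeight_one χ ψ R) (charWeight_mul χ ψ R))
  refine ⟨w, fun E _ _ _ => ?_⟩
  rw [← hw _ Module.finrank_pos, sum_irreduciblesOfDegreeDvd_eq]
  simp only [charWeight_minpoly_pow]

lemma norm_sum_mulChar_prod_sub_mul_addChar_neg_le {p : ℕ} [Fact p.Prime] (hp : 3 ≤ p)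
    {χ : MulChar (ZMod p) ℂ} (hχ : χ ≠ 1) (ψ : AddChar (ZMod p) ℂ) {R : Finset (ZMod p)}
    (hR : 0 ∈ R) :
    ‖∑ x, χ (∏ r ∈ R, (r - x)) * ψ (-x)‖ ≤ R.card * √p := by
  classical
  have hp0 : (0 : ℝ) < p := by exact_mod_cast (by omega : 0 < p)
  choose w hw using fun ψ : AddChar (ZMod p) ℂ =>
    exists_sum_mulChar_norm_mul_addChar_trace_eq hχ ψ ⟨0, hR⟩
  have hsum : ∀ (E : Type) [Field E] [Fintype E] [Algebra (ZMod p) E],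
      ∑ z : E, χ (Algebra.norm (ZMod p) (∏ r ∈ R, (algebraMap (ZMod p) E r - (z ^ p - z)))) =
        -∑ t : AddChar (ZMod p) ℂ × Fin R.card, w t.1 t.2 ^ Module.finrank (ZMod p) E := by
    intro E _ _ _
    have h1 := sum_addChar_sum_mul_trace_eq (K := ZMod p) fun x : E =>
      χ (Algebra.norm (ZMod p) (∏ r ∈ R, (algebraMap (ZMod p) E r - x)))
    rw [ZMod.card] at h1
    rw [← h1, Fintype.sum_prod_type, ← Finset.sum_neg_distrib]
    exact Finset.sum_congr rfl fun ψ _ => hw ψ E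
  have hbound : ∀ ν : ℕ, 1 ≤ ν → ‖∑ t : AddChar (ZMod p) ℂ × Fin R.card, (w t.1 t.2 ^ 2) ^ ν‖ ≤
      (p * (4 * (R.card * p) + 3) : ℝ) * (p : ℝ) ^ ν := by
    intro ν hν
    have h2ν : 2 * ν ≠ 0 := by omega
    let E := GaloisField p (2 * ν)
    have : Fintype E := Fintype.ofFinite E
    have hcard : Fintype.card E = (p ^ ν) ^ 2 := by
      rw [← Nat.card_eq_fintype_card, GaloisField.card p _ h2ν, ← pow_mul, mul_comm]
    let f₁ : E[X] := (1 - X ^ (p - 1)) *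
      ∏ r ∈ R.erase 0, (C (algebraMap (ZMod p) E r) - (X ^ p - X))
    have hf₁ : f₁.coeff 0 ≠ 0 := by
      simp only [f₁, coeff_zero_eq_eval_zero, eval_mul, eval_prod, eval_sub, eval_pow, eval_X,
        eval_C, eval_one, zero_pow (by omega : p - 1 ≠ 0), zero_pow (by omega : p ≠ 0), sub_zero,
        one_mul]
      refine Finset.prod_ne_zero_iff.2 fun r hr => ?_
      exact (_root_.map_ne_zero _).2 (Finset.ne_of_mem_erase hr)
    have hf : X * f₁ = ∏ r ∈ R, (C (algebraMap (ZMod p) E r) - (X ^ p - X)) := by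
      have hpow : (X : E[X]) ^ p = X ^ (p - 1) * X := by
        rw [← pow_succ, Nat.sub_add_cancel (by omega)]
      rw [← Finset.mul_prod_erase R _ hR, map_zero, map_zero]
      simp only [f₁]
      rw [← mul_assoc]
      congr 1
      rw [hpow]; ring
    have hdeg : (X * f₁).natDegree ≤ R.card * p := by
      rw [hf]
      refine (natDegree_prod_le _ _).trans ((Finset.sum_le_card_nsmul _ _ p fun r _ => ?_).trans_eq
        (smul_eq_mul _ _))
      have h1 : (X ^ p - X : E[X]).natDegree ≤ p :=
        (natDegree_sub_le _ _).trans (max_le (natDegree_X_pow_le p)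
          (natDegree_X_le.trans (by omega)))
      exact (natDegree_sub_le _ _).trans (max_le (by simp) h1)
    have h1 := norm_sum_mulChar_norm_eval_le hp (by omega : ν ≠ 0) hcard hχ hf₁
    have h2 : ∀ z : E, (X * f₁).eval z = ∏ r ∈ R, (algebraMap (ZMod p) E r - (z ^ p - z)) := by
      intro z
      rw [hf, eval_prod]
      simp
    simp only [h2] at h1
    rw [hsum E, norm_neg, GaloisField.finrank p h2ν] at h1
    simp only [← pow_mul]
    refine h1.trans ?_
    have h3 : ((X * f₁).natDegree : ℝ) ≤ R.card * p := by exact_mod_cast hdeg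
    gcongr
  have hw1 : ∀ i, ‖w ψ i‖ ≤ √p := by
    intro i
    have h1 := norm_le_of_norm_sum_pow_le (w := fun t : AddChar (ZMod p) ℂ × Fin R.card =>
      w t.1 t.2 ^ 2) hp0 hbound (ψ, i)
    rw [norm_pow] at h1
    exact Real.le_sqrt_of_sq_le h1
  have h1 := hw ψ (ZMod p)
  simp only [Algebra.norm_self, Algebra.trace_self, Module.finrank_self, pow_one,
    Algebra.algebraMap_self, RingHom.id_apply, MonoidHom.id_apply, LinearMap.id_apply] at h1
  rw [h1, norm_neg]
  refine (norm_sum_le _ _).trans ((Finset.sum_le_card_nsmul _ _ _ fun i _ => hw1 i).trans_eq ?_)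
  simp

/-- Weil's bound for mixed character sums along squarefree split polynomials over `ZMod p`. -/
theorem norm_sum_mulChar_prod_sub_mul_addChar_le {p : ℕ} [Fact p.Prime] (hp : 3 ≤ p)
    {χ : MulChar (ZMod p) ℂ} (hχ : χ ≠ 1) (ψ : AddChar (ZMod p) ℂ) {R : Finset (ZMod p)}
    (hR : R.Nonempty) :
    ‖∑ x, χ (∏ r ∈ R, (x - r)) * ψ x‖ ≤ R.card * √p := by
  classical
  obtain ⟨r₀, hr₀⟩ := hR
  have hinj : Function.Injective fun r : ZMod p => r - r₀ := sub_left_injective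
  have h0 : 0 ∈ R.image fun r => r - r₀ := Finset.mem_image.2 ⟨r₀, hr₀, sub_self r₀⟩
  have h1 := norm_sum_mulChar_prod_sub_mul_addChar_neg_le hp hχ ψ⁻¹ h0
  rw [Finset.card_image_of_injective _ hinj] at h1
  refine le_trans ?_ h1
  have h2 : ∑ x, χ (∏ r ∈ R, (x - r)) * ψ x = (χ ((-1) ^ R.card) * ψ r₀) *
      ∑ x, χ (∏ r ∈ R.image (fun r => r - r₀), (r - x)) * ψ⁻¹ (-x) := by
    rw [Finset.mul_sum, ← Equiv.sum_comp (Equiv.addLeft r₀)]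
    refine Finset.sum_congr rfl fun x _ => ?_
    have h3 : ∏ r ∈ R, (r₀ + x - r) =
        (-1) ^ R.card * ∏ r ∈ R.image (fun r => r - r₀), (r - x) := by
      rw [Finset.prod_image fun a _ b _ h => hinj h, ← Finset.prod_const, ← Finset.prod_mul_distrib]
      refine Finset.prod_congr rfl fun r _ => ?_
      ring
    rw [Equiv.coe_addLeft, h3, map_mul, AddChar.map_add_eq_mul, AddChar.inv_apply, neg_neg]
    ring
  rw [h2, norm_mul, norm_mul, AddChar.norm_apply, mul_one]
  exact mul_le_of_le_one_left (norm_nonneg _) (DirichletCharacter.norm_le_one χ _)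
end

section

variable {p : ℕ} [Fact p.Prime]

/-- Averaging over a difference set does not exceed the largest Fourier coefficient. -/
lemma norm_sum_sum_sub_le {G : Type*} [AddCommGroup G] [Fintype G] {f : G → ℂ} {B : ℝ}
    (hB : ∀ ψ : AddChar G ℂ, ‖∑ x, f x * ψ x‖ ≤ B) (A : Finset G) :
    ‖∑ a ∈ A, ∑ b ∈ A, f (a - b)‖ ≤ A.card * B := by
  classical
  have hinv : ∀ x, (Fintype.card G : ℂ) * f x =
      ∑ ψ : AddChar G ℂ, (∑ y, f y * ψ y) * ψ (-x) := by
    intro x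
    simp only [Finset.sum_mul]
    rw [Finset.sum_comm, Finset.sum_eq_single x]
    · simp only [mul_assoc, ← AddChar.map_add_eq_mul, add_neg_cancel, AddChar.map_zero_eq_one]
      simp [mul_comm]
    · intro y _ hy
      simp only [mul_assoc, ← AddChar.map_add_eq_mul, ← Finset.mul_sum]
      rw [AddChar.sum_apply_eq_ite, if_neg (by rwa [← sub_eq_add_neg, sub_eq_zero]), mul_zero]
    · simp
  have hhat : ∀ ψ : AddChar G ℂ, (∑ a ∈ A, ψ (-a)) * ∑ b ∈ A, ψ b =
      ((‖∑ b ∈ A, ψ b‖ ^ 2 : ℝ) : ℂ) := by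
    intro ψ
    rw [Complex.ofReal_pow, ← Complex.conj_mul', map_sum]
    simp only [AddChar.map_neg_eq_conj]
  have hparseval : ∑ ψ : AddChar G ℂ, ‖∑ b ∈ A, ψ b‖ ^ 2 = Fintype.card G * A.card := by
    have : ((∑ ψ : AddChar G ℂ, ‖∑ b ∈ A, ψ b‖ ^ 2 : ℝ) : ℂ) = Fintype.card G * A.card := by
      rw [Complex.ofReal_sum]
      simp only [← hhat, Finset.sum_mul_sum, ← AddChar.map_add_eq_mul]
      rw [Finset.sum_comm]
      have h1 : ∀ a ∈ A, ∑ ψ : AddChar G ℂ, ∑ b ∈ A, ψ (-a + b) = Fintype.card G := by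
        intro a ha
        rw [Finset.sum_comm]
        simp only [AddChar.sum_apply_eq_ite, neg_add_eq_zero]
        simp [ha]
      rw [Finset.sum_congr rfl h1]
      simp [mul_comm]
    exact_mod_cast this
  have hid : (Fintype.card G : ℂ) * ∑ a ∈ A, ∑ b ∈ A, f (a - b) =
      ∑ ψ : AddChar G ℂ, (∑ y, f y * ψ y) * ((‖∑ b ∈ A, ψ b‖ ^ 2 : ℝ) : ℂ) := by
    have h1 : ∀ a b : G, (Fintype.card G : ℂ) * f (a - b) =
        ∑ ψ : AddChar G ℂ, (∑ y, f y * ψ y) * (ψ (-a) * ψ b) := by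
      intro a b
      rw [hinv]
      refine Finset.sum_congr rfl fun ψ _ => ?_
      rw [← AddChar.map_add_eq_mul, neg_sub, sub_eq_neg_add]
    have h2 : ∀ ψ : AddChar G ℂ, ((‖∑ b ∈ A, ψ b‖ ^ 2 : ℝ) : ℂ) =
        ∑ a ∈ A, ∑ b ∈ A, ψ (-a) * ψ b := fun ψ => by rw [← hhat, Finset.sum_mul_sum]
    simp only [h2, Finset.mul_sum (s := A), h1]
    rw [Finset.sum_congr rfl fun a _ => Finset.sum_comm, Finset.sum_comm]
  have hpos : (0 : ℝ) < Fintype.card G := by exact_mod_cast Fintype.card_pos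
  refine le_of_mul_le_mul_left ?_ hpos
  have h1 := congrArg norm hid
  rw [norm_mul, Complex.norm_natCast] at h1
  rw [h1]
  calc _ ≤ ∑ ψ : AddChar G ℂ, B * ‖∑ b ∈ A, ψ b‖ ^ 2 := by
        refine (norm_sum_le _ _).trans (Finset.sum_le_sum fun ψ _ => ?_)
        rw [norm_mul, Complex.norm_real, Real.norm_of_nonneg (sq_nonneg _)]
        exact mul_le_mul_of_nonneg_right (hB ψ) (sq_nonneg _)
    _ = _ := by rw [← Finset.mul_sum, hparseval]; ring

/-- The ratio `χ((n + k)!) / χ(n!)` as a function of `n` modulo `p`. -/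
noncomputable def shiftRatio (χ : MulChar (ZMod p) ℂ) (k : ℕ) (x : ZMod p) : ℂ :=
  χ (∏ i ∈ Finset.range k, (x + (i + 1 : ℕ)))

lemma norm_shiftRatio_le (χ : MulChar (ZMod p) ℂ) (k : ℕ) (x : ZMod p) :
    ‖shiftRatio χ k x‖ ≤ 1 := DirichletCharacter.norm_le_one χ _

lemma norm_sum_shiftRatio_mul_conj_le (hp : 3 ≤ p) {χ : MulChar (ZMod p) ℂ} (hχ : χ ≠ 1)
    {j k : ℕ} (hjk : j < k) (hkp : k ≤ p) (ψ : AddChar (ZMod p) ℂ) :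
    ‖∑ x, shiftRatio χ k x * starRingEnd ℂ (shiftRatio χ j x) * ψ x‖ ≤ k * √p := by
  classical
  let root : ℕ → ZMod p := fun i => -((i + 1 : ℕ) : ZMod p)
  have hinj : Set.InjOn root (Finset.range k) := by
    intro a ha b hb h
    rw [Finset.coe_range, Set.mem_Iio] at ha hb
    have h1 : ((a + 1 : ℕ) : ZMod p) = ((b + 1 : ℕ) : ZMod p) := neg_injective h
    have h2 : (a : ZMod p) = b := by push_cast at h1; exact add_right_cancel h1
    have h3 := congrArg ZMod.val h2
    rwa [ZMod.val_natCast_of_lt (by omega), ZMod.val_natCast_of_lt (by omega)] at h3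
  set R := (Finset.Ico j k).image root with hR
  have hsub : (Finset.Ico j k : Set ℕ) ⊆ Finset.range k := by
    intro i hi
    simp only [Finset.coe_Ico, Set.mem_Ico, Finset.coe_range, Set.mem_Iio] at hi ⊢
    exact hi.2
  have hRcard : R.card = k - j := by
    rw [hR, Finset.card_image_of_injOn (hinj.mono hsub), Nat.card_Ico]
  have hprod : ∀ x : ZMod p, ∏ r ∈ R, (x - r) = ∏ i ∈ Finset.Ico j k, (x + (i + 1 : ℕ)) := by
    intro x
    rw [hR, Finset.prod_image fun a ha b hb h => hinj.mono hsub ha hb h]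
    exact Finset.prod_congr rfl fun i _ => sub_neg_eq_add _ _
  have hweil := norm_sum_mulChar_prod_sub_mul_addChar_le hp hχ ψ (R := R)
    (Finset.card_pos.1 (by omega))
  set Z := (Finset.range j).image root with hZ
  have hZcard : Z.card ≤ j := by simpa using Finset.card_image_le (s := Finset.range j) (f := root)
  have hdiff : ∀ x, ‖shiftRatio χ k x * starRingEnd ℂ (shiftRatio χ j x) * ψ x -
      χ (∏ r ∈ R, (x - r)) * ψ x‖ ≤ if x ∈ Z then 1 else 0 := by
    intro x
    have h1 : shiftRatio χ k x = shiftRatio χ j x * χ (∏ r ∈ R, (x - r)) := by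
      rw [hprod, shiftRatio, shiftRatio, ← map_mul, Finset.prod_range_mul_prod_Ico _ hjk.le]
    rw [h1, ← sub_mul, norm_mul, AddChar.norm_apply, mul_one]
    have h2 : shiftRatio χ j x * χ (∏ r ∈ R, (x - r)) * starRingEnd ℂ (shiftRatio χ j x) -
        χ (∏ r ∈ R, (x - r)) = χ (∏ r ∈ R, (x - r)) * ((‖shiftRatio χ j x‖ : ℂ) ^ 2 - 1) := by
      rw [← Complex.mul_conj']; ring
    rw [h2, norm_mul]
    split_ifs with hx
    · refine mul_le_one₀ (DirichletCharacter.norm_le_one χ _) (norm_nonneg _) ?_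
      have h3 := norm_shiftRatio_le χ j x
      have h4 : ((‖shiftRatio χ j x‖ : ℂ) ^ 2 - 1) = ((‖shiftRatio χ j x‖ ^ 2 - 1 : ℝ) : ℂ) := by
        push_cast; rfl
      rw [h4, Complex.norm_real, Real.norm_eq_abs, abs_le]
      constructor <;> nlinarith [norm_nonneg (shiftRatio χ j x)]
    · have h3 : ∏ i ∈ Finset.range j, (x + (i + 1 : ℕ)) ≠ 0 := by
        refine Finset.prod_ne_zero_iff.2 fun i hi h => hx ?_
        exact Finset.mem_image.2 ⟨i, hi, (eq_neg_of_add_eq_zero_left h).symm⟩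
      have h4 : ‖shiftRatio χ j x‖ = 1 :=
        DirichletCharacter.unit_norm_eq_one χ (Units.mk0 _ h3)
      simp [h4]
  have h1 : ‖∑ x, shiftRatio χ k x * starRingEnd ℂ (shiftRatio χ j x) * ψ x -
      ∑ x, χ (∏ r ∈ R, (x - r)) * ψ x‖ ≤ j := by
    rw [← Finset.sum_sub_distrib]
    refine (norm_sum_le _ _).trans ((Finset.sum_le_sum fun x _ => hdiff x).trans ?_)
    rw [Finset.sum_ite_mem, Finset.univ_inter]
    simpa using hZcard
  have h2 : (1 : ℝ) ≤ √p := by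
    rw [Real.one_le_sqrt]; exact_mod_cast (by omega : 1 ≤ p)
  have h3 := norm_le_norm_add_norm_sub'
    (∑ x, shiftRatio χ k x * starRingEnd ℂ (shiftRatio χ j x) * ψ x)
    (∑ x, χ (∏ r ∈ R, (x - r)) * ψ x)
  rw [hRcard, Nat.cast_sub hjk.le] at hweil
  nlinarith [(Nat.cast_nonneg j : (0 : ℝ) ≤ j)]

end

section

variable {p : ℕ} [Fact p.Prime]

lemma norm_sum_sum_shiftRatio_mul_conj_le (hp : 3 ≤ p) {χ : MulChar (ZMod p) ℂ} (hχ : χ ≠ 1)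
    {K j k : ℕ} (hjk : j ≠ k) (hj : j ≤ K) (hk : k ≤ K) (hKp : K ≤ p) (A : Finset (ZMod p)) :
    ‖∑ a ∈ A, ∑ b ∈ A, shiftRatio χ k (a - b) * starRingEnd ℂ (shiftRatio χ j (a - b))‖ ≤
      A.card * (K * √p) := by
  wlog h : j < k generalizing j k
  · have h1 := this hjk.symm hk hj (lt_of_le_of_ne (not_lt.1 h) hjk.symm)
    rw [← RCLike.norm_conj] at h1
    simpa only [map_sum, map_mul, Complex.conj_conj, mul_comm] using h1
  · refine norm_sum_sum_sub_le (f := fun x => shiftRatio χ k x * starRingEnd ℂ (shiftRatio χ j x))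
      (fun ψ => (norm_sum_shiftRatio_mul_conj_le hp hχ h (hk.trans hKp) ψ).trans ?_) A
    gcongr

/-- Mean square over a difference set of short sums of shift ratios. -/
lemma sum_sum_norm_sq_sum_shiftRatio_le (hp : 3 ≤ p) {χ : MulChar (ZMod p) ℂ} (hχ : χ ≠ 1)
    {K : ℕ} (hKp : K ≤ p) {u : ℕ → ℂ} (hu : ∀ k, ‖u k‖ ≤ 1) (A : Finset (ZMod p)) :
    ∑ a ∈ A, ∑ b ∈ A, ‖∑ k ∈ Finset.range K, shiftRatio χ k (a - b) * u k‖ ^ 2 ≤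
      K * (A.card : ℝ) ^ 2 + (K : ℝ) ^ 3 * A.card * √p := by
  have hid : ((∑ a ∈ A, ∑ b ∈ A, ‖∑ k ∈ Finset.range K, shiftRatio χ k (a - b) * u k‖ ^ 2 : ℝ) : ℂ)
      = ∑ k ∈ Finset.range K, ∑ j ∈ Finset.range K, (u k * starRingEnd ℂ (u j)) *
        ∑ a ∈ A, ∑ b ∈ A, shiftRatio χ k (a - b) * starRingEnd ℂ (shiftRatio χ j (a - b)) := by
    have h1 : ∀ x : ZMod p, ((‖∑ k ∈ Finset.range K, shiftRatio χ k x * u k‖ : ℂ)) ^ 2 =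
        ∑ k ∈ Finset.range K, ∑ j ∈ Finset.range K, (u k * starRingEnd ℂ (u j)) *
          (shiftRatio χ k x * starRingEnd ℂ (shiftRatio χ j x)) := by
      intro x
      rw [← Complex.mul_conj', map_sum, Finset.sum_mul_sum]
      refine Finset.sum_congr rfl fun k _ => Finset.sum_congr rfl fun j _ => ?_
      rw [map_mul]; ring
    push_cast
    simp only [h1, Finset.mul_sum]
    rw [Finset.sum_congr rfl fun a _ => Finset.sum_comm, Finset.sum_comm]
    refine Finset.sum_congr rfl fun k _ => ?_
    rw [Finset.sum_congr rfl fun a _ => Finset.sum_comm, Finset.sum_comm]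
  have hterm : ∀ k ∈ Finset.range K, ∀ j ∈ Finset.range K, ‖(u k * starRingEnd ℂ (u j)) *
      ∑ a ∈ A, ∑ b ∈ A, shiftRatio χ k (a - b) * starRingEnd ℂ (shiftRatio χ j (a - b))‖ ≤
      (if j = k then (A.card : ℝ) ^ 2 else 0) + A.card * (K * √p) := by
    intro k hk j hj
    rw [Finset.mem_range] at hk hj
    have h1 : ‖u k * starRingEnd ℂ (u j)‖ ≤ 1 := by
      rw [norm_mul, RCLike.norm_conj]
      exact mul_le_one₀ (hu k) (norm_nonneg _) (hu j)
    rw [norm_mul]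
    refine (mul_le_of_le_one_left (norm_nonneg _) h1).trans ?_
    split_ifs with hjk
    · refine le_add_of_le_of_nonneg ?_ (by positivity)
      have h2 : ∀ x : ZMod p, ‖shiftRatio χ k x * starRingEnd ℂ (shiftRatio χ j x)‖ ≤ 1 := by
        intro x
        rw [norm_mul, RCLike.norm_conj]
        exact mul_le_one₀ (norm_shiftRatio_le _ _ _) (norm_nonneg _) (norm_shiftRatio_le _ _ _)
      calc _ ≤ ∑ a ∈ A, ∑ b ∈ A, (1 : ℝ) := (norm_sum_le _ _).trans
            (Finset.sum_le_sum fun a _ => (norm_sum_le _ _).trans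
              (Finset.sum_le_sum fun b _ => h2 _))
        _ = _ := by simp [sq]
    · rw [zero_add]
      exact norm_sum_sum_shiftRatio_mul_conj_le hp hχ hjk hj.le hk.le hKp A
  have h1 := congrArg norm hid
  rw [Complex.norm_real, Real.norm_of_nonneg (by positivity)] at h1
  rw [h1]
  refine (norm_sum_le _ _).trans ((Finset.sum_le_sum fun k hk => (norm_sum_le _ _).trans
    (Finset.sum_le_sum fun j hj => hterm k hk j hj)).trans_eq ?_)
  have h2 : ∀ k ∈ Finset.range K, ∑ j ∈ Finset.range K,
      ((if j = k then (A.card : ℝ) ^ 2 else 0) + A.card * (K * √p)) =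
      (A.card : ℝ) ^ 2 + K * (A.card * (K * √p)) := by
    intro k hk
    rw [Finset.sum_add_distrib, Finset.sum_ite_eq' _ _ _, if_pos hk]
    simp
  rw [Finset.sum_congr rfl h2]
  simp only [Finset.sum_const, Finset.card_range, nsmul_eq_mul]
  ring

lemma mul_sum_norm_sq_sum_shiftRatio_le (hp : 3 ≤ p) {χ : MulChar (ZMod p) ℂ} (hχ : χ ≠ 1)
    {N K : ℕ} (hN : 2 * N ≤ p) (hKp : K ≤ p) {u : ℕ → ℂ} (hu : ∀ k, ‖u k‖ ≤ 1) :
    N * ∑ n ∈ Finset.Icc 1 N, ‖∑ k ∈ Finset.range K, shiftRatio χ k n * u k‖ ^ 2 ≤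
      4 * K * (N : ℝ) ^ 2 + 2 * (K : ℝ) ^ 3 * N * √p := by
  classical
  set A := (Finset.range (2 * N)).image (Nat.cast : ℕ → ZMod p) with hA
  have hinj : Set.InjOn (Nat.cast : ℕ → ZMod p) (Finset.range (2 * N)) := by
    intro a ha b hb h
    rw [Finset.coe_range, Set.mem_Iio] at ha hb
    have h3 := congrArg ZMod.val h
    rwa [ZMod.val_natCast_of_lt (by omega), ZMod.val_natCast_of_lt (by omega)] at h3
  have hcard : A.card = 2 * N := by
    rw [hA, Finset.card_image_of_injOn hinj, Finset.card_range]
  have h1 := sum_sum_norm_sq_sum_shiftRatio_le hp hχ hKp hu A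
  rw [hcard] at h1
  set g : ZMod p → ℝ := fun x => ‖∑ k ∈ Finset.range K, shiftRatio χ k x * u k‖ ^ 2 with hg
  have hg0 : ∀ x, 0 ≤ g x := fun x => sq_nonneg _
  have h2 : (N : ℝ) * ∑ n ∈ Finset.Icc 1 N, g n ≤ ∑ a ∈ A, ∑ b ∈ A, g (a - b) := by
    rw [hA, Finset.sum_comm, Finset.sum_image fun a ha b hb h => hinj ha hb h]
    calc (N : ℝ) * ∑ n ∈ Finset.Icc 1 N, g n
        = ∑ b ∈ Finset.range N, ∑ n ∈ Finset.Icc 1 N, g n := by simp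
      _ ≤ ∑ b ∈ Finset.range N, ∑ a ∈ A, g (a - b) := by
          refine Finset.sum_le_sum fun b hb => ?_
          rw [Finset.mem_range] at hb
          have hinj' : Set.InjOn (fun n : ℕ => ((n + b : ℕ) : ZMod p)) (Finset.Icc 1 N) := by
            intro n hn m hm h
            rw [Finset.coe_Icc, Set.mem_Icc] at hn hm
            have h3 := hinj (by simp; omega) (by simp; omega) h
            omega
          have h4 : ∑ n ∈ Finset.Icc 1 N, g n =
              ∑ a ∈ (Finset.Icc 1 N).image (fun n : ℕ => ((n + b : ℕ) : ZMod p)), g (a - b) := by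
            rw [Finset.sum_image fun a ha b hb h => hinj' ha hb h]
            refine Finset.sum_congr rfl fun n _ => ?_
            rw [Nat.cast_add, add_sub_cancel_right]
          rw [h4]
          refine Finset.sum_le_sum_of_subset_of_nonneg ?_ fun _ _ _ => hg0 _
          intro a ha
          obtain ⟨n, hn, rfl⟩ := Finset.mem_image.1 ha
          rw [Finset.mem_Icc] at hn
          exact Finset.mem_image_of_mem _ (Finset.mem_range.2 (by omega))
      _ ≤ _ := by
          refine Finset.sum_le_sum_of_subset_of_nonneg (Finset.range_mono (by omega))
            fun _ _ _ => Finset.sum_nonneg fun _ _ => hg0 _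
  refine (h2.trans h1).trans_eq ?_
  push_cast
  ring

lemma mul_norm_sum_mulChar_factorial_le (χ : MulChar (ZMod p) ℂ) (ψ : AddChar (ZMod p) ℂ)
    (N K : ℕ) :
    K * ‖∑ n ∈ Finset.Icc 1 N, χ (n.factorial : ZMod p) * ψ n‖ ≤ (K : ℝ) ^ 2 +
      ∑ n ∈ Finset.Icc 1 N, ‖∑ k ∈ Finset.range K, shiftRatio χ k n * ψ k‖ := by
  set s : ℕ → ℂ := fun n => χ (n.factorial : ZMod p) * ψ n with hs
  have hs1 : ∀ n, ‖s n‖ ≤ 1 := by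
    intro n
    rw [hs]
    simp only [norm_mul, AddChar.norm_apply, mul_one]
    exact DirichletCharacter.norm_le_one χ _
  have hshift : ∀ k, ‖∑ n ∈ Finset.Icc 1 N, s n - ∑ n ∈ Finset.Icc 1 N, s (n + k)‖ ≤ 2 * k := by
    intro k
    induction k with
    | zero => simp
    | succ k ih =>
      have h1 : ∑ n ∈ Finset.Icc 1 N, s (n + k) - ∑ n ∈ Finset.Icc 1 N, s (n + (k + 1)) =
          s (1 + k) - s (N + 1 + k) := by
        have h2 := Finset.sum_Ico_sub (fun n => -s (n + k)) (show 1 ≤ N + 1 by omega)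
        rw [Finset.Ico_add_one_right_eq_Icc] at h2
        rw [← Finset.sum_sub_distrib, show s (1 + k) - s (N + 1 + k) =
          -s (N + 1 + k) - -s (1 + k) by ring, ← h2]
        refine Finset.sum_congr rfl fun n _ => ?_
        rw [show n + 1 + k = n + (k + 1) by ring]
        ring
      have h2 : ∑ n ∈ Finset.Icc 1 N, s n - ∑ n ∈ Finset.Icc 1 N, s (n + (k + 1)) =
          (∑ n ∈ Finset.Icc 1 N, s n - ∑ n ∈ Finset.Icc 1 N, s (n + k)) +
            (s (1 + k) - s (N + 1 + k)) := by rw [← h1]; ring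
      rw [h2]
      push_cast
      have h3 := norm_add_le (∑ n ∈ Finset.Icc 1 N, s n - ∑ n ∈ Finset.Icc 1 N, s (n + k))
        (s (1 + k) - s (N + 1 + k))
      have h4 := norm_sub_le (s (1 + k)) (s (N + 1 + k))
      linarith [hs1 (1 + k), hs1 (N + 1 + k)]
  have hfac : ∀ n k : ℕ, s (n + k) = s n * (shiftRatio χ k n * ψ k) := by
    intro n k
    have h1 : (((n + k).factorial : ℕ) : ZMod p) =
        n.factorial * ∏ i ∈ Finset.range k, ((n : ZMod p) + (i + 1 : ℕ)) := by
      induction k with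
      | zero => simp
      | succ k ih =>
        rw [Finset.prod_range_succ, ← mul_assoc, ← ih, ← add_assoc, Nat.factorial_succ]
        push_cast; ring
    simp only [hs, shiftRatio]
    rw [h1, map_mul, Nat.cast_add, AddChar.map_add_eq_mul]
    ring
  have hsum : (K : ℂ) * ∑ n ∈ Finset.Icc 1 N, s n =
      ∑ k ∈ Finset.range K, (∑ n ∈ Finset.Icc 1 N, s n - ∑ n ∈ Finset.Icc 1 N, s (n + k)) +
        ∑ n ∈ Finset.Icc 1 N, s n * ∑ k ∈ Finset.range K, shiftRatio χ k n * ψ k := by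
    simp only [Finset.mul_sum, ← hfac, Finset.sum_sub_distrib]
    rw [Finset.sum_comm (s := Finset.Icc 1 N) (t := Finset.range K)]
    simp [Finset.mul_sum]
  have h1 := congrArg norm hsum
  rw [norm_mul, Complex.norm_natCast] at h1
  rw [h1]
  refine (norm_add_le _ _).trans (add_le_add ?_ ?_)
  · refine (norm_sum_le _ _).trans ((Finset.sum_le_sum fun k _ => hshift k).trans ?_)
    rw [← Finset.mul_sum]
    have h2 := Finset.sum_range_id_mul_two K
    have h3 : (∑ k ∈ Finset.range K, (k : ℝ)) * 2 = K * ((K - 1 : ℕ) : ℝ) := by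
      rw [← Nat.cast_mul, ← h2]; push_cast; rfl
    have h4 : ((K - 1 : ℕ) : ℝ) ≤ K := by exact_mod_cast Nat.sub_le K 1
    nlinarith [(Nat.cast_nonneg K : (0 : ℝ) ≤ K)]
  · refine (norm_sum_le _ _).trans (Finset.sum_le_sum fun n _ => ?_)
    rw [norm_mul]
    exact mul_le_of_le_one_left (norm_nonneg _) (hs1 n)

end

section

/-- Character sums along factorials of an initial segment. -/
theorem norm_sum_mulChar_factorial_mul_addChar_le {p : ℕ} [Fact p.Prime] (hp : 3 ≤ p)
    {χ : MulChar (ZMod p) ℂ} (hχ : χ ≠ 1) (ψ : AddChar (ZMod p) ℂ) {N : ℕ} (hN : 1 ≤ N)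
    (hNp : 2 * N ≤ p) :
    ‖∑ n ∈ Finset.Icc 1 N, χ (n.factorial : ZMod p) * ψ n‖ ≤
      5 * ((N : ℝ) ^ (3 / 4 : ℝ) * (p : ℝ) ^ (1 / 8 : ℝ)) := by
  set S := ‖∑ n ∈ Finset.Icc 1 N, χ (n.factorial : ZMod p) * ψ n‖ with hS
  have hp0 : (0 : ℝ) < p := by exact_mod_cast (by omega : 0 < p)
  have hN0 : (0 : ℝ) < N := by exact_mod_cast hN
  set y : ℝ := (N : ℝ) ^ (1 / 4 : ℝ) with hy
  set z : ℝ := (p : ℝ) ^ (1 / 8 : ℝ) with hz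
  have hy0 : 0 < y := Real.rpow_pos_of_pos hN0 _
  have hz0 : 0 < z := Real.rpow_pos_of_pos hp0 _
  have hy1 : 1 ≤ y := Real.one_le_rpow (by exact_mod_cast hN) (by norm_num)
  have hz1 : 1 ≤ z := Real.one_le_rpow (by exact_mod_cast (by omega : 1 ≤ p)) (by norm_num)
  have hNy : (N : ℝ) = y ^ 4 := by
    rw [hy, ← Real.rpow_natCast, ← Real.rpow_mul hN0.le]; norm_num
  have hpz : √(p : ℝ) = z ^ 4 := by
    rw [hz, ← Real.rpow_natCast, ← Real.rpow_mul hp0.le, Real.sqrt_eq_rpow]; norm_num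
  have hN34 : (N : ℝ) ^ (3 / 4 : ℝ) = y ^ 3 := by
    rw [hy, ← Real.rpow_natCast, ← Real.rpow_mul hN0.le]; norm_num
  rw [hN34]
  rcases lt_or_ge y z with hyz | hyz
  · have h1 : S ≤ N := by
      refine (norm_sum_le _ _).trans ((Finset.sum_le_card_nsmul _ _ 1 fun n _ => ?_).trans_eq ?_)
      · rw [norm_mul, AddChar.norm_apply, mul_one]
        exact DirichletCharacter.norm_le_one χ _
      · simp
    have h2 : y ^ 4 ≤ y ^ 3 * z := by
      rw [pow_succ]; exact mul_le_mul_of_nonneg_left hyz.le (by positivity)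
    have h3 : 0 ≤ y ^ 3 * z := by positivity
    linarith
  · have hx1 : 1 ≤ y ^ 2 / z ^ 2 := by
      rw [one_le_div (by positivity)]; gcongr
    set K := ⌊y ^ 2 / z ^ 2⌋₊ with hK
    have hK1 : 1 ≤ K := Nat.one_le_floor_iff _ |>.2 hx1
    have hKle : (K : ℝ) ≤ y ^ 2 / z ^ 2 := Nat.floor_le (by positivity)
    have hKge : y ^ 2 / z ^ 2 < K + 1 := Nat.lt_floor_add_one _
    have hK1' : (1 : ℝ) ≤ K := by exact_mod_cast hK1
    have hKz : (K : ℝ) * z ^ 2 ≤ y ^ 2 := (le_div_iff₀ (by positivity)).1 hKle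
    have hKz' : y ^ 2 ≤ 2 * K * z ^ 2 :=
      (div_le_iff₀ (by positivity)).1 (hKge.le.trans (by linarith))
    have hKN : K ≤ N := by
      have h1 : (K : ℝ) ≤ N := by
        rw [hNy]
        nlinarith [one_le_pow₀ hz1 (n := 2), one_le_pow₀ hy1 (n := 2)]
      exact_mod_cast h1
    have h1 := mul_norm_sum_mulChar_factorial_le χ ψ N K
    have h2 := mul_sum_norm_sq_sum_shiftRatio_le hp hχ (N := N) hNp (by omega : K ≤ p)
      (u := fun k => ψ k) (fun k => (AddChar.norm_apply ψ _).le)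
    set V := ∑ n ∈ Finset.Icc 1 N, ‖∑ k ∈ Finset.range K, shiftRatio χ k n * ψ k‖ with hV
    have h3 : V ^ 2 ≤ N * ∑ n ∈ Finset.Icc 1 N,
        ‖∑ k ∈ Finset.range K, shiftRatio χ k n * ψ k‖ ^ 2 := by
      have := sq_sum_le_card_mul_sum_sq (s := Finset.Icc 1 N)
        (f := fun n : ℕ => ‖∑ k ∈ Finset.range K, shiftRatio χ k n * ψ k‖)
      rwa [Nat.card_Icc, Nat.add_sub_cancel] at this
    have h4 := h3.trans h2
    rw [hNy, hpz] at h4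
    have hV0 : 0 ≤ V := Finset.sum_nonneg fun _ _ => norm_nonneg _
    have h5 : V ^ 2 ≤ (4 * (K * (y ^ 3 * z))) ^ 2 := by
      refine h4.trans ?_
      have e1 : 4 * K * (y ^ 4) ^ 2 ≤ 8 * (K * (y ^ 3 * z)) ^ 2 := by
        have : 4 * K * (y ^ 4) ^ 2 = 4 * K * y ^ 6 * y ^ 2 := by ring
        rw [this]
        calc 4 * K * y ^ 6 * y ^ 2 ≤ 4 * K * y ^ 6 * (2 * K * z ^ 2) := by gcongr
          _ = _ := by ring
      have e2 : 2 * (K : ℝ) ^ 3 * y ^ 4 * z ^ 4 ≤ 2 * (K * (y ^ 3 * z)) ^ 2 := by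
        calc 2 * (K : ℝ) ^ 3 * y ^ 4 * z ^ 4 = 2 * (K : ℝ) ^ 2 * y ^ 4 * z ^ 2 * (K * z ^ 2) := by
              ring
          _ ≤ 2 * (K : ℝ) ^ 2 * y ^ 4 * z ^ 2 * y ^ 2 := by gcongr
          _ = _ := by ring
      nlinarith [sq_nonneg (K * (y ^ 3 * z))]
    have h6 : V ≤ 4 * (K * (y ^ 3 * z)) := by
      exact (sq_le_sq₀ hV0 (by positivity)).1 h5
    have h7 : (K : ℝ) ≤ y ^ 3 * z := by
      have : y ^ 2 ≤ y ^ 3 * z := by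
        calc y ^ 2 = y ^ 2 * 1 * 1 := by ring
          _ ≤ y ^ 2 * y * z := by gcongr
          _ = _ := by ring
      nlinarith [one_le_pow₀ hz1 (n := 2)]
    have h8 : (K : ℝ) * S ≤ K * (5 * (y ^ 3 * z)) := by nlinarith
    exact le_of_mul_le_mul_left h8 (by linarith)
end

section

/-- The tuples with entries in `[1, N]` and sum `N`. -/
def positiveCompositions (ℓ N : ℕ) : Finset (Fin ℓ → ℕ) :=
  (Fintype.piFinset fun _ : Fin ℓ => Finset.Icc 1 N).filter fun n => ∑ i, n i = N

theorem mem_positiveCompositions {ℓ N : ℕ} {n : Fin ℓ → ℕ} :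
    n ∈ positiveCompositions ℓ N ↔ (∀ i, 0 < n i) ∧ ∑ i, n i = N := by
  simp only [positiveCompositions, Finset.mem_filter, Fintype.mem_piFinset, Finset.mem_Icc]
  refine ⟨fun h => ⟨fun i => (h.1 i).1, h.2⟩, fun h => ⟨fun i => ⟨h.1 i, ?_⟩, h.2⟩⟩
  exact h.2 ▸ Finset.single_le_sum (fun j _ => Nat.zero_le (n j)) (Finset.mem_univ i)

theorem card_positiveCompositions {ℓ N : ℕ} (hℓ : 1 ≤ ℓ) (hN : 1 ≤ N) :
    (positiveCompositions ℓ N).card = (N - 1).choose (ℓ - 1) := by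
  rcases lt_or_ge N ℓ with h | h
  · rw [Nat.choose_eq_zero_of_lt (by omega), Finset.card_eq_zero,
      Finset.eq_empty_iff_forall_notMem]
    intro n hn
    rw [mem_positiveCompositions] at hn
    have := Finset.card_nsmul_le_sum Finset.univ n 1 fun i _ => hn.1 i
    rw [Finset.card_univ, Fintype.card_fin, smul_eq_mul, mul_one, hn.2] at this
    omega
  · have key := Finset.card_finsuppAntidiag_nat_eq_choose (s := (Finset.univ : Finset (Fin ℓ)))
      (N - ℓ)
    rw [Finset.card_univ, Fintype.card_fin, show ℓ + (N - ℓ) - 1 = N - 1 by omega,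
      ← Nat.choose_symm (by omega), show N - 1 - (N - ℓ) = ℓ - 1 by omega] at key
    rw [← key]
    refine (Finset.card_bij' (fun f _ i => f i + 1)
      (fun n _ => Finsupp.equivFunOnFinite.symm fun i => n i - 1) ?_ ?_ ?_ ?_).symm
    · intro f hf
      rw [Finset.mem_finsuppAntidiag] at hf
      rw [mem_positiveCompositions]
      refine ⟨fun i => Nat.succ_pos _, ?_⟩
      rw [Finset.sum_add_distrib, hf.1]
      simp
      omega
    · intro n hn
      rw [mem_positiveCompositions] at hn
      rw [Finset.mem_finsuppAntidiag]
      refine ⟨?_, Finset.subset_univ _⟩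
      have : ∑ i, (n i - 1) + ∑ _i : Fin ℓ, 1 = N := by
        rw [← Finset.sum_add_distrib, ← hn.2]
        exact Finset.sum_congr rfl fun i _ => Nat.sub_add_cancel (hn.1 i)
      simp only [Finset.sum_const, Finset.card_univ, Fintype.card_fin, smul_eq_mul,
        mul_one] at this
      simp only [Finsupp.coe_equivFunOnFinite_symm]
      omega
    · intro f _
      ext i
      simp
    · intro n hn
      rw [mem_positiveCompositions] at hn
      ext i
      have := hn.1 i
      simp only [Finsupp.coe_equivFunOnFinite_symm]
      omega

theorem addChar_map_sum {ι A R : Type*} [AddCommMonoid A] [CommMonoid R] (ψ : AddChar A R)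
    (s : Finset ι) (f : ι → A) : ψ (∑ i ∈ s, f i) = ∏ i ∈ s, ψ (f i) :=
  map_prod ψ.toMonoidHom (fun i => Multiplicative.ofAdd (f i)) s

/-- Detecting the sum by additive characters. -/
theorem sum_positiveCompositions_eq {p : ℕ} [Fact p.Prime] {ℓ N : ℕ} (hN : N < p)
    (hℓN : ℓ * N < p) (f : ℕ → ℂ) :
    (p : ℂ) * ∑ n ∈ positiveCompositions ℓ N, ∏ i, f (n i) =
      ∑ ψ : AddChar (ZMod p) ℂ, ψ (-(N : ZMod p)) * (∑ n ∈ Finset.Icc 1 N, f n * ψ n) ^ ℓ := by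
  have h : ∀ n ∈ Fintype.piFinset fun _ : Fin ℓ => Finset.Icc 1 N,
      (((∑ i, n i : ℕ) : ZMod p) - N = 0 ↔ ∑ i, n i = N) := by
    intro n hn
    rw [sub_eq_zero]
    refine ⟨fun h => ?_, fun h => by rw [h]⟩
    have hlt : ∑ i, n i < p := by
      refine (Finset.sum_le_card_nsmul _ _ N fun i _ => ?_).trans_lt ?_
      · exact (Finset.mem_Icc.mp (Fintype.mem_piFinset.mp hn i)).2
      · simpa using hℓN
    have := congrArg ZMod.val h
    rwa [ZMod.val_natCast_of_lt hlt, ZMod.val_natCast_of_lt hN] at this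
  have h2 : ∀ ψ : AddChar (ZMod p) ℂ,
      ψ (-(N : ZMod p)) * (∑ n ∈ Finset.Icc 1 N, f n * ψ n) ^ ℓ =
        ∑ n ∈ Fintype.piFinset fun _ : Fin ℓ => Finset.Icc 1 N,
          (∏ i, f (n i)) * ψ (((∑ i, n i : ℕ) : ZMod p) - N) := by
    intro ψ
    rw [Finset.sum_pow', Finset.mul_sum]
    refine Finset.sum_congr rfl fun n _ => ?_
    rw [Finset.prod_mul_distrib, sub_eq_add_neg, AddChar.map_add_eq_mul, Nat.cast_sum,
      addChar_map_sum]
    ring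
  rw [Finset.sum_congr rfl fun ψ _ => h2 ψ, Finset.sum_comm, positiveCompositions,
    Finset.sum_filter, Finset.mul_sum]
  refine Finset.sum_congr rfl fun n hn => ?_
  rw [← Finset.mul_sum, AddChar.sum_apply_eq_ite]
  simp only [h n hn, ZMod.card]
  split_ifs <;> ring

theorem norm_sum_positiveCompositions_le {p : ℕ} [Fact p.Prime] {ℓ N : ℕ} (hN : N < p)
    (hℓN : ℓ * N < p) (f : ℕ → ℂ) {B : ℝ}
    (hB : ∀ ψ : AddChar (ZMod p) ℂ, ‖∑ n ∈ Finset.Icc 1 N, f n * ψ n‖ ≤ B) :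
    ‖∑ n ∈ positiveCompositions ℓ N, ∏ i, f (n i)‖ ≤ B ^ ℓ := by
  have hp : (0 : ℝ) < p := by exact_mod_cast (Fact.out : p.Prime).pos
  refine le_of_mul_le_mul_left ?_ hp
  calc (p : ℝ) * ‖∑ n ∈ positiveCompositions ℓ N, ∏ i, f (n i)‖
      = ‖(p : ℂ) * ∑ n ∈ positiveCompositions ℓ N, ∏ i, f (n i)‖ := by simp
    _ ≤ ∑ _ψ : AddChar (ZMod p) ℂ, B ^ ℓ := by
        rw [sum_positiveCompositions_eq hN hℓN]
        refine norm_sum_le_of_le _ fun ψ _ => ?_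
        rw [norm_mul, AddChar.norm_apply, one_mul, norm_pow]
        exact pow_le_pow_left₀ (norm_nonneg _) (hB ψ) ℓ
    _ = p * B ^ ℓ := by
        rw [Finset.sum_const, Finset.card_univ, AddChar.card_eq, ZMod.card, nsmul_eq_mul]

/-- The number of compositions of `N` with a prescribed product of factorials deviates from its
expected value by at most the power of a bound for the twisted character sums. -/
theorem abs_card_filter_sub_le {p : ℕ} [Fact p.Prime] (hp : 3 ≤ p) {ℓ N : ℕ} (hN : N < p)
    (hℓN : ℓ * N < p) {a : ZMod p} (ha : a ≠ 0) {B : ℝ} (hB0 : 0 ≤ B)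
    (hB : ∀ χ : MulChar (ZMod p) ℂ, χ ≠ 1 → ∀ ψ : AddChar (ZMod p) ℂ,
      ‖∑ n ∈ Finset.Icc 1 N, χ (n.factorial : ZMod p) * ψ n‖ ≤ B) :
    |(((positiveCompositions ℓ N).filter fun n =>
        ∏ i, ((n i).factorial : ZMod p) = a).card : ℝ) -
      ((positiveCompositions ℓ N).card : ℝ) / ((p : ℝ) - 1)| ≤ B ^ ℓ := by
  classical
  set F := positiveCompositions ℓ N with hF
  set G := (F.filter fun n => ∏ i, ((n i).factorial : ZMod p) = a).card with hG
  have hp3 : (3 : ℝ) ≤ p := by exact_mod_cast hp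
  have hpr : p.Prime := Fact.out
  have htot : ((p.totient : ℕ) : ℂ) = (p : ℂ) - 1 := by
    rw [Nat.totient_prime hpr, Nat.cast_pred hpr.pos]
  have hfac : ∀ n ∈ F, ∏ i, ((n i).factorial : ZMod p) ≠ 0 := by
    intro n hn
    rw [Finset.prod_ne_zero_iff]
    intro i _
    rw [hF, mem_positiveCompositions] at hn
    have : n i ≤ N :=
      hn.2 ▸ Finset.single_le_sum (fun j _ => Nat.zero_le (n j)) (Finset.mem_univ i)
    rw [Ne, ZMod.natCast_eq_zero_iff, hpr.dvd_factorial]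
    omega
  let T : MulChar (ZMod p) ℂ → ℂ := fun χ =>
    χ a⁻¹ * ∑ n ∈ F, ∏ i, χ ((n i).factorial : ZMod p)
  have hsum : ∑ χ, T χ = ((p : ℂ) - 1) * G := by
    have : ∀ χ : MulChar (ZMod p) ℂ,
        T χ = ∑ n ∈ F, χ a⁻¹ * χ (∏ i, ((n i).factorial : ZMod p)) := by
      intro χ
      simp only [T, Finset.mul_sum, map_prod]
    rw [Finset.sum_congr rfl fun χ _ => this χ, Finset.sum_comm,
      Finset.sum_congr rfl fun n _ =>
        DirichletCharacter.sum_char_inv_mul_char_eq ℂ (isUnit_iff_ne_zero.mpr ha) _,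
      ← Finset.sum_filter, Finset.sum_const, htot, nsmul_eq_mul, mul_comm, hG]
    simp only [eq_comm]
  have hone : T 1 = F.card := by
    simp only [T]
    rw [MulChar.one_apply (isUnit_iff_ne_zero.mpr (inv_ne_zero ha)), one_mul,
      Finset.card_eq_sum_ones, Nat.cast_sum]
    refine Finset.sum_congr rfl fun n hn => ?_
    rw [← map_prod, MulChar.one_apply (isUnit_iff_ne_zero.mpr (hfac n hn)), Nat.cast_one]
  have hT : ∀ χ : MulChar (ZMod p) ℂ, χ ≠ 1 → ‖T χ‖ ≤ B ^ ℓ := by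
    intro χ hχ
    rw [norm_mul]
    refine (mul_le_of_le_one_left (norm_nonneg _) (DirichletCharacter.norm_le_one χ _)).trans ?_
    exact norm_sum_positiveCompositions_le hN hℓN (fun n => χ (n.factorial : ZMod p)) (hB χ hχ)
  have hcard : (Finset.univ.erase (1 : MulChar (ZMod p) ℂ)).card = p - 2 := by
    rw [Finset.card_erase_of_mem (Finset.mem_univ _), Finset.card_univ, ← Nat.card_eq_fintype_card]
    have := DirichletCharacter.card_eq_totient_of_hasEnoughRootsOfUnity ℂ p
    rw [Nat.totient_prime hpr] at this
    unfold DirichletCharacter at this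
    omega
  have hdiff : ((p : ℂ) - 1) * G - F.card = ∑ χ ∈ Finset.univ.erase 1, T χ := by
    rw [← hsum, ← Finset.add_sum_erase _ _ (Finset.mem_univ 1), hone]
    ring
  have hbound : |((p : ℝ) - 1) * G - F.card| ≤ ((p : ℝ) - 2) * B ^ ℓ := by
    calc |((p : ℝ) - 1) * G - F.card| = ‖((p : ℂ) - 1) * G - F.card‖ := by
          rw [← Real.norm_eq_abs, ← Complex.norm_real]
          push_cast
          rfl
      _ ≤ ((p - 2 : ℕ) : ℝ) * B ^ ℓ := by
          rw [hdiff, ← hcard, ← nsmul_eq_mul, ← Finset.sum_const]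
          exact norm_sum_le_of_le _ fun χ hχ => hT χ (Finset.ne_of_mem_erase hχ)
      _ = ((p : ℝ) - 2) * B ^ ℓ := by
          rw [Nat.cast_sub (by omega)]
          norm_num
  have hp1 : (0 : ℝ) < p - 1 := by linarith
  rw [show (G : ℝ) - F.card / ((p : ℝ) - 1) = (((p : ℝ) - 1) * G - F.card) / (p - 1) by
    field_simp, abs_div, abs_of_pos hp1, div_le_iff₀ hp1]
  nlinarith [pow_nonneg hB0 ℓ]

end

/-- Theorem 10 (products of factorials with fixed sum of arguments): for fixed
`ℓ ≥ 1`, for every odd prime `p`, every `N` with `1 ≤ N < p/ℓ` and every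
`a ≢ 0 (mod p)`, the number `G_ℓ(a,N)` of `ℓ`-tuples of positive integers with
`n_1 + ⋯ + n_ℓ = N` and `n_1! ⋯ n_ℓ! ≡ a (mod p)` satisfies
`|G_ℓ(a,N) - binom(N-1, ℓ-1)/(p-1)| ≤ C N^{3ℓ/4} p^{(ℓ+6)/8} (log p)^{(ℓ-2)/4}`. -/
theorem count_factorial_products_fixed_sum (ℓ : ℕ) (hℓ : 1 ≤ ℓ) :
    ∃ C : ℝ, 0 < C ∧ ∀ p : ℕ, p.Prime → Odd p →
      ∀ N : ℕ, 1 ≤ N → ℓ * N < p →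
      ∀ a : ZMod p, a ≠ 0 →
        |({n : Fin ℓ → ℕ | (∀ i, 0 < n i) ∧ (∑ i, n i) = N ∧
              (∏ i, ((n i).factorial : ZMod p)) = a}.ncard : ℝ) -
            (Nat.choose (N - 1) (ℓ - 1) : ℝ) / ((p : ℝ) - 1)| ≤
          C * (N : ℝ) ^ (3 * (ℓ : ℝ) / 4) * (p : ℝ) ^ (((ℓ : ℝ) + 6) / 8) *
            (Real.log p) ^ (((ℓ : ℝ) - 2) / 4) := by
  refine ⟨5 ^ ℓ, by positivity, fun p hpr hodd N hN hℓN a ha => ?_⟩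
  have : Fact p.Prime := ⟨hpr⟩
  have hp : 3 ≤ p := by
    obtain ⟨k, rfl⟩ := hodd
    have := hpr.two_le
    omega
  have hNp : N < p := (Nat.le_mul_of_pos_left N hℓ).trans_lt hℓN
  have hp3 : (3 : ℝ) ≤ p := by exact_mod_cast hp
  have hN1 : (1 : ℝ) ≤ N := by exact_mod_cast hN
  have hlog : 1 ≤ Real.log p := by
    rw [Real.le_log_iff_exp_le (by linarith)]
    linarith [Real.exp_one_lt_d9]
  have hset : {n : Fin ℓ → ℕ | (∀ i, 0 < n i) ∧ (∑ i, n i) = N ∧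
      (∏ i, ((n i).factorial : ZMod p)) = a} =
      ↑((positiveCompositions ℓ N).filter fun n => ∏ i, ((n i).factorial : ZMod p) = a) := by
    ext n
    simp only [Set.mem_ofPred_eq, Finset.coe_filter, mem_positiveCompositions, and_assoc]
  rw [hset, Set.ncard_coe_finset, ← card_positiveCompositions hℓ hN]
  rcases hℓ.eq_or_lt with rfl | hℓ2
  · have hcard : (positiveCompositions 1 N).card = 1 := by
      rw [card_positiveCompositions le_rfl hN]
      simp
    have hG : (((positiveCompositions 1 N).filter fun n =>
        ∏ i, ((n i).factorial : ZMod p) = a).card : ℝ) ≤ 1 := by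
      exact Nat.cast_le_one.mpr ((Finset.card_filter_le _ _).trans_eq hcard)
    have hfrac : (1 : ℝ) / (p - 1) ≤ 1 := by
      rw [div_le_one (by linarith)]
      linarith
    have hfrac0 : (0 : ℝ) ≤ 1 / (p - 1) := by
      have : (0 : ℝ) < p - 1 := by linarith
      positivity
    rw [hcard, Nat.cast_one]
    refine (abs_sub_le_iff.mpr ⟨by linarith, ?_⟩ : _ ≤ (1 : ℝ)).trans ?_
    · have : (0 : ℝ) ≤ (((positiveCompositions 1 N).filter fun n =>
        ∏ i, ((n i).factorial : ZMod p) = a).card : ℝ) := Nat.cast_nonneg _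
      linarith
    · have h1 : 1 ≤ (N : ℝ) ^ (3 * (1 : ℝ) / 4) := Real.one_le_rpow hN1 (by norm_num)
      have h2 : (p : ℝ) ^ (1 / 4 : ℝ) ≤ (p : ℝ) ^ (((1 : ℝ) + 6) / 8) :=
        Real.rpow_le_rpow_of_exponent_le (by linarith) (by norm_num)
      have h3 : (p : ℝ) ^ (-(1 / 4) : ℝ) ≤ Real.log p ^ (((1 : ℝ) - 2) / 4) := by
        rw [show ((1 : ℝ) - 2) / 4 = -(1 / 4) by norm_num]
        exact Real.rpow_le_rpow_of_nonpos (by linarith)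
          (Real.log_le_self (by linarith)) (by norm_num)
      have h4 : (p : ℝ) ^ (1 / 4 : ℝ) * (p : ℝ) ^ (-(1 / 4) : ℝ) = 1 := by
        rw [← Real.rpow_add (by linarith)]
        norm_num
      calc (1 : ℝ) = 1 * 1 * ((p : ℝ) ^ (1 / 4 : ℝ) * (p : ℝ) ^ (-(1 / 4) : ℝ)) := by
            rw [h4]; norm_num
        _ ≤ 5 ^ 1 * (N : ℝ) ^ (3 * (1 : ℝ) / 4) *
              ((p : ℝ) ^ (((1 : ℝ) + 6) / 8) * Real.log p ^ (((1 : ℝ) - 2) / 4)) := by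
            gcongr
            norm_num
        _ = _ := by ring
  · have hNp2 : 2 * N ≤ p := (Nat.mul_le_mul_right N hℓ2).trans hℓN.le
    refine (abs_card_filter_sub_le hp hNp hℓN ha (by positivity) fun χ hχ ψ =>
      norm_sum_mulChar_factorial_mul_addChar_le hp hχ ψ hN hNp2).trans ?_
    have hℓ' : (2 : ℝ) ≤ ℓ := by exact_mod_cast hℓ2
    have h1 : ((N : ℝ) ^ (3 / 4 : ℝ)) ^ ℓ = (N : ℝ) ^ (3 * (ℓ : ℝ) / 4) := by
      rw [← Real.rpow_natCast, ← Real.rpow_mul (by linarith)]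
      congr 1
      ring
    have h2 : ((p : ℝ) ^ (1 / 8 : ℝ)) ^ ℓ ≤ (p : ℝ) ^ (((ℓ : ℝ) + 6) / 8) := by
      rw [← Real.rpow_natCast, ← Real.rpow_mul (by linarith)]
      exact Real.rpow_le_rpow_of_exponent_le (by linarith) (by linarith)
    have h3 : 1 ≤ Real.log p ^ (((ℓ : ℝ) - 2) / 4) :=
      Real.one_le_rpow hlog (by linarith)
    rw [mul_pow, mul_pow, h1]
    calc (5 : ℝ) ^ ℓ * ((N : ℝ) ^ (3 * (ℓ : ℝ) / 4) * ((p : ℝ) ^ (1 / 8 : ℝ)) ^ ℓ)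
        = 5 ^ ℓ * (N : ℝ) ^ (3 * (ℓ : ℝ) / 4) * ((p : ℝ) ^ (1 / 8 : ℝ)) ^ ℓ * 1 := by ring
      _ ≤ _ := by gcongr
end

section
/- There exists an absolute constant C > 0 such that for every odd prime p, all integers H, N with 0 ≤ H < H + N < p, and every residue a modulo p, the number of integers n with H+1 ≤ n ≤ H+N and n! ≡ a (mod p) is at most C · N^{2/3}. -/
open Finset Polynomial in
/-- For `k ≥ 1`, at most `k` integers `n < p` satisfy `n! ≡ (n + k)! ≡ a (mod p)`, since `n + 1` is
then a root of a polynomial of degree `k`. -/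
theorem card_filter_factorial_eq_add_le (p : ℕ) [Fact p.Prime] (S : Finset ℕ)
    (hS : ∀ n ∈ S, n < p) (a : ZMod p) (hSa : ∀ n ∈ S, (n.factorial : ZMod p) = a)
    {k : ℕ} (hk : 0 < k) : #{n ∈ S | n + k ∈ S} ≤ k := by
  have hnat : (ascPochhammer (ZMod p) k).natDegree = k := ascPochhammer_natDegree _ k
  have hdeg : 0 < (ascPochhammer (ZMod p) k).degree :=
    natDegree_pos_iff_degree_pos.mp (hnat.symm ▸ hk)
  calc #{n ∈ S | n + k ∈ S} ≤ #(ascPochhammer (ZMod p) k - C 1).roots.toFinset := by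
        refine card_le_card_of_injOn (fun n => ((n + 1 : ℕ) : ZMod p)) ?_ ?_
        · intro n hn
          obtain ⟨hn, hnk⟩ := mem_filter.mp hn
          have hne : (n.factorial : ZMod p) ≠ 0 := by
            rw [Ne, ZMod.natCast_eq_zero_iff, (Fact.out : p.Prime).dvd_factorial]
            exact not_le.mpr (hS n hn)
          have hmul := congrArg (Nat.cast : ℕ → ZMod p) (Nat.factorial_mul_ascFactorial n k)
          rw [Nat.cast_mul, hSa _ hnk, ← hSa n hn] at hmul
          have hone : (((n + 1).ascFactorial k : ℕ) : ZMod p) = 1 :=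
            mul_left_cancel₀ hne (hmul.trans (mul_one _).symm)
          rw [mem_coe, Multiset.mem_toFinset, mem_roots_sub_C hdeg]
          exact (ascPochhammer_eval_cast _ k (n + 1)).symm.trans
            ((congrArg _ (ascPochhammer_nat_eq_ascFactorial (n + 1) k)).trans hone)
        · intro m hm n hn hmn
          have hm' := hS m (mem_filter.mp hm).1
          have hn' := hS n (mem_filter.mp hn).1
          have : (m : ZMod p) = n := by simpa using hmn
          rw [ZMod.natCast_eq_natCast_iff'] at this
          rwa [Nat.mod_eq_of_lt hm', Nat.mod_eq_of_lt hn'] at this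
    _ ≤ (ascPochhammer (ZMod p) k - C 1).roots.card := Multiset.toFinset_card_le _
    _ ≤ k := (card_roots_sub_C' hdeg).trans hnat.le

open Finset in
/-- A subset of an interval of length `N` in which each difference `k ≥ 1` occurs at most `k` times
has few elements: at most `K ^ 2` are followed by another one within distance `K`, and the others
are `K`-separated. -/
theorem card_le_of_card_filter_add_le (S : Finset ℕ) (H N K : ℕ) (hK : 0 < K)
    (hS : S ⊆ Icc (H + 1) (H + N)) (hgap : ∀ k, 0 < k → #{n ∈ S | n + k ∈ S} ≤ k) :
    #S ≤ K ^ 2 + (N / K + 1) := by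
  rw [← card_filter_add_card_filter_not (s := S) (fun n => ∃ k ∈ Icc 1 K, n + k ∈ S)]
  refine add_le_add ?_ ?_
  · calc #{n ∈ S | ∃ k ∈ Icc 1 K, n + k ∈ S}
        ≤ #((Icc 1 K).biUnion fun k => {n ∈ S | n + k ∈ S}) := by
          refine card_le_card fun n hn => ?_
          obtain ⟨hn, k, hk, hnk⟩ := mem_filter.mp hn
          exact mem_biUnion.mpr ⟨k, hk, mem_filter.mpr ⟨hn, hnk⟩⟩
      _ ≤ #(Icc 1 K) * K := card_biUnion_le_card_mul _ _ _ fun k hk =>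
          (hgap k (mem_Icc.mp hk).1).trans (mem_Icc.mp hk).2
      _ = K ^ 2 := by simp [sq]
  · rw [← card_range (N / K + 1)]
    refine card_le_card_of_injOn (fun n => (n - (H + 1)) / K) ?_ ?_
    · intro n hn
      have := mem_Icc.mp (hS (mem_filter.mp hn).1)
      rw [mem_coe, mem_range]
      exact Nat.lt_succ_of_le (Nat.div_le_div_right (by omega))
    · have separated : ∀ m ∈ S, ∀ n ∈ S, (¬ ∃ k ∈ Icc 1 K, m + k ∈ S) →
          (m - (H + 1)) / K = (n - (H + 1)) / K → n ≤ m := by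
        intro m hm n hn hsep hmn
        by_contra! hlt
        have := mem_Icc.mp (hS hm)
        have hm' := Nat.div_add_mod (m - (H + 1)) K
        have hn' := Nat.div_add_mod (n - (H + 1)) K
        have hlt' := Nat.mod_lt (n - (H + 1)) hK
        rw [hmn] at hm'
        refine hsep ⟨n - m, mem_Icc.mpr ⟨by omega, by omega⟩, ?_⟩
        rwa [Nat.add_sub_cancel' hlt.le]
      intro m hm n hn hmn
      obtain ⟨hm, hm'⟩ := mem_filter.mp hm
      obtain ⟨hn, hn'⟩ := mem_filter.mp hn
      exact le_antisymm (separated n hn m hm hn' hmn.symm) (separated m hm n hn hm' hmn)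

/-- Theorem 11 (multiplicity of values of `n!` mod `p`): there is an absolute
constant `C > 0` such that for every odd prime `p`, all `0 ≤ H < H + N < p`
and every residue `a` mod `p`, the number of `n ∈ {H+1, …, H+N}` with
`n! ≡ a (mod p)` is at most `C N^{2/3}`. -/
theorem count_factorial_value :
    ∃ C : ℝ, 0 < C ∧ ∀ p : ℕ, p.Prime → Odd p →
      ∀ H N : ℕ, 0 < N → H + N < p →
      ∀ a : ZMod p,
        (((Finset.Icc (H + 1) (H + N)).filter
            fun n => ((n.factorial : ZMod p)) = a).card : ℝ) ≤
          C * (N : ℝ) ^ ((2 : ℝ) / 3) := by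
  refine ⟨6, by norm_num, fun p hp _ H N hN hHN a => ?_⟩
  have : Fact p.Prime := ⟨hp⟩
  set S := (Finset.Icc (H + 1) (H + N)).filter fun n => ((n.factorial : ZMod p)) = a
  have hsub : S ⊆ Finset.Icc (H + 1) (H + N) := Finset.filter_subset _ _
  set x : ℝ := (N : ℝ) ^ ((1 : ℝ) / 3) with hx
  have hx1 : 1 ≤ x := Real.one_le_rpow (by exact_mod_cast hN) (by norm_num)
  have hx2 : (N : ℝ) ^ ((2 : ℝ) / 3) = x ^ 2 := by
    rw [hx, ← Real.rpow_mul_natCast N.cast_nonneg]; norm_num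
  have hx3 : (N : ℝ) = x ^ 3 := by
    rw [hx, ← Real.rpow_mul_natCast N.cast_nonneg]; norm_num
  have hKle : (⌈x⌉₊ : ℝ) ≤ 2 * x := by
    linarith [Nat.ceil_lt_add_one (zero_le_one.trans hx1)]
  have hcard := card_le_of_card_filter_add_le S H N ⌈x⌉₊ (Nat.ceil_pos.mpr (by linarith)) hsub
    fun k hk => card_filter_factorial_eq_add_le p S
      (fun n hn => (Finset.mem_Icc.mp (hsub hn)).2.trans_lt hHN) a
      (fun n hn => (Finset.mem_filter.mp hn).2) hk
  have hdiv : ((N / ⌈x⌉₊ : ℕ) : ℝ) ≤ x ^ 2 := by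
    refine Nat.cast_div_le.trans (div_le_of_le_mul₀ (Nat.cast_nonneg _) (sq_nonneg x) ?_)
    rw [hx3, pow_succ]
    exact mul_le_mul_of_nonneg_left (Nat.le_ceil x) (sq_nonneg x)
  have hsq : (⌈x⌉₊ : ℝ) ^ 2 ≤ (2 * x) ^ 2 := pow_le_pow_left₀ (Nat.cast_nonneg _) hKle 2
  calc (S.card : ℝ) ≤ (⌈x⌉₊ : ℝ) ^ 2 + (((N / ⌈x⌉₊ : ℕ) : ℝ) + 1) := by exact_mod_cast hcard
    _ ≤ 6 * (N : ℝ) ^ ((2 : ℝ) / 3) := by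
      rw [hx2]
      nlinarith
end

section
/- There exists an absolute constant C > 0 such that for every odd prime p, the number of residue classes a modulo p with a ≢ 0 (mod p) that can be written as a ≡ n_1! n_2! (mod p) with integers 1 ≤ n_1, n_2 ≤ p−1 is at least (5/8)·p − C · p^{1/2} · (log p)². -/
open Finset

/-- The indicator function of the residue classes with odd least nonnegative representative. -/
noncomputable def oddIndicator (p : ℕ) (x : ZMod p) : ℂ := if Odd x.val then 1 else 0

theorem ZMod.sum_eq_sum_range {M : Type*} [AddCommMonoid M] (p : ℕ) [NeZero p] (f : ZMod p → M) :
    ∑ x, f x = ∑ i ∈ range p, f i := by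
  refine Finset.sum_nbij' ZMod.val (fun i ↦ (i : ZMod p)) ?_ ?_ ?_ ?_ ?_
  · simp [ZMod.val_lt]
  · simp
  · simp
  · intro i hi
    exact ZMod.val_cast_of_lt (mem_range.1 hi)
  · simp

theorem Finset.sum_range_ite_odd {M : Type*} [AddCommMonoid M] (f : ℕ → M) (q : ℕ) :
    ∑ i ∈ range (2 * q + 1), (if Odd i then f i else 0) = ∑ j ∈ range q, f (2 * j + 1) := by
  induction q with
  | zero => simp
  | succ q ih =>
    have h : 2 * (q + 1) + 1 = 2 * q + 1 + 1 + 1 := by ring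
    have h' : ¬ Odd (2 * q + 1 + 1) := by grind
    rw [h, sum_range_succ, sum_range_succ, ih, sum_range_succ]
    simp [h']

theorem factorial_mul_factorial_sub (p : ℕ) [Fact p.Prime] (k : ℕ) (hk : k ≤ p - 1) :
    (k.factorial : ZMod p) * ((p - 1 - k).factorial : ZMod p) = (-1) ^ (k + 1) := by
  induction k with
  | zero => simp [ZMod.wilsons_lemma]
  | succ k ih =>
    obtain ⟨m, rfl⟩ : ∃ m, p = k + m + 2 := ⟨p - k - 2, by omega⟩
    have h1 : k + m + 2 - 1 - k = m + 1 := by omega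
    have h2 : k + m + 2 - 1 - (k + 1) = m := by omega
    have h0 : ((k + m + 2 : ℕ) : ZMod (k + m + 2)) = 0 := ZMod.natCast_self _
    have ih := ih (by omega)
    rw [h1] at ih
    rw [h2, pow_succ, ← ih]
    simp only [Nat.factorial_succ]
    push_cast at h0 ⊢
    linear_combination (k.factorial * m.factorial : ZMod (k + m + 2)) * h0

section ExponentialSums

variable {p : ℕ} [Fact p.Prime]

local notation "χ" => (ZMod.stdAddChar : AddChar (ZMod p) ℂ)

theorem norm_sq_sum_stdAddChar_quadratic (hp : p ≠ 2) (a b : ZMod p) (hb : b ≠ 0) :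
    ‖∑ n : ZMod p, χ (a * n + b * (n ^ 2 - n))‖ ^ 2 = p := by
  have h2 : (2 : ZMod p) ≠ 0 := by
    have := Fact.mk hp
    exact Ring.two_ne_zero (by rwa [ZMod.ringChar_zmod_n])
  have key : (∑ n : ZMod p, χ (a * n + b * (n ^ 2 - n))) *
      (starRingEnd ℂ) (∑ n : ZMod p, χ (a * n + b * (n ^ 2 - n))) = p := by
    rw [map_sum, sum_mul_sum, sum_comm]
    calc ∑ m : ZMod p, ∑ n : ZMod p, χ (a * n + b * (n ^ 2 - n)) *
          (starRingEnd ℂ) (χ (a * m + b * (m ^ 2 - m)))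
        = ∑ m : ZMod p, ∑ h : ZMod p,
            χ (a * h + b * (h ^ 2 - h)) * χ (m * (2 * b * h)) := by
          refine sum_congr rfl fun m _ ↦ ?_
          rw [← Equiv.sum_comp (Equiv.addRight m)]
          refine sum_congr rfl fun h _ ↦ ?_
          rw [← AddChar.map_neg_eq_conj, ← AddChar.map_add_eq_mul, ← AddChar.map_add_eq_mul]
          congr 1
          simp only [Equiv.coe_addRight]
          ring
      _ = ∑ h : ZMod p, χ (a * h + b * (h ^ 2 - h)) * (if h = 0 then (p : ℂ) else 0) := by
          rw [sum_comm]
          refine sum_congr rfl fun h _ ↦ ?_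
          rw [← mul_sum, AddChar.sum_mulShift _ (ZMod.isPrimitive_stdAddChar p)]
          simp [h2, hb, ZMod.card]
      _ = p := by simp
  rw [Complex.mul_conj, Complex.normSq_eq_norm_sq] at key
  exact_mod_cast key

theorem norm_sum_stdAddChar_quadratic_le (hp : p ≠ 2) (a b : ZMod p) (h : a ≠ 0 ∨ b ≠ 0) :
    ‖∑ n : ZMod p, χ (a * n + b * (n ^ 2 - n))‖ ≤ √p := by
  by_cases hb : b = 0
  · have ha : a ≠ 0 := by tauto
    have := AddChar.sum_mulShift (R := ZMod p) a (ZMod.isPrimitive_stdAddChar p)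
    simp only [hb, zero_mul, add_zero]
    simp only [mul_comm a, this, ha, if_false]
    simp
  · exact Real.le_sqrt_of_sq_le (norm_sq_sum_stdAddChar_quadratic hp a b hb).le

theorem ZMod.eq_inv_mul_sum_dft (f : ZMod p → ℂ) (n : ZMod p) :
    f n = (p : ℂ)⁻¹ * ∑ k, χ (k * n) * ZMod.dft f k := by
  conv_lhs => rw [← LinearEquiv.symm_apply_apply ZMod.dft f, ZMod.invDFT_apply]
  simp

open ZMod in
theorem norm_sum_mul_sub_le (hp : p ≠ 2) (f g : ZMod p → ℂ) :
    ‖∑ n, f n * g (n ^ 2 - n) - (p : ℂ)⁻¹ * ((∑ n, f n) * ∑ n, g n)‖ ≤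
      ((p : ℝ)⁻¹) ^ 2 * (√p * ((∑ k, ‖dft f k‖) * ∑ k, ‖dft g k‖)) := by
  have hp0 : (p : ℂ) ≠ 0 := by exact_mod_cast (Fact.out : p.Prime).ne_zero
  set S : ZMod p → ZMod p → ℂ := fun a b ↦ ∑ n : ZMod p, χ (a * n + b * (n ^ 2 - n)) with hS
  have expand : ∑ n, f n * g (n ^ 2 - n) =
      ((p : ℂ)⁻¹) ^ 2 * ∑ a, ∑ b, dft f a * dft g b * S a b := by
    calc ∑ n, f n * g (n ^ 2 - n)
        = ∑ n, ((p : ℂ)⁻¹) ^ 2 * ∑ a, ∑ b, dft f a * dft g b * χ (a * n + b * (n ^ 2 - n)) := by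
          refine sum_congr rfl fun n _ ↦ ?_
          rw [eq_inv_mul_sum_dft f n, eq_inv_mul_sum_dft g (n ^ 2 - n), mul_mul_mul_comm,
            sum_mul_sum, sq (p : ℂ)⁻¹]
          congr 1
          refine sum_congr rfl fun a _ ↦ sum_congr rfl fun b _ ↦ ?_
          rw [AddChar.map_add_eq_mul]
          ring
      _ = _ := by
          rw [← mul_sum, sum_comm]
          congr 1
          refine sum_congr rfl fun a _ ↦ ?_
          rw [sum_comm]
          simp only [hS, mul_sum]
  have main : (p : ℂ)⁻¹ * ((∑ n, f n) * ∑ n, g n) =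
      ((p : ℂ)⁻¹) ^ 2 *
        ∑ a : ZMod p, ∑ b : ZMod p, if a = 0 ∧ b = 0 then dft f a * dft g b * S a b else 0 := by
    simp only [ite_and, sum_ite_irrel, sum_const_zero, sum_ite_eq', mem_univ, if_true]
    have : S 0 0 = p := by simp [hS, ZMod.card]
    rw [this, dft_apply_zero, dft_apply_zero]
    field_simp
  rw [expand, main, ← mul_sub, norm_mul, norm_pow, norm_inv, Complex.norm_natCast,
    ← sum_sub_distrib]
  gcongr
  simp only [← sum_sub_distrib]
  rw [sum_mul_sum, mul_sum]
  refine (norm_sum_le _ _).trans (sum_le_sum fun a _ ↦ ?_)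
  rw [mul_sum]
  refine (norm_sum_le _ _).trans (sum_le_sum fun b _ ↦ ?_)
  split_ifs with h
  · simp only [sub_self, norm_zero]
    positivity
  · rw [sub_zero, norm_mul, norm_mul, mul_comm]
    gcongr
    exact norm_sum_stdAddChar_quadratic_le hp a b (by tauto)

theorem abs_sub_two_mul_val_le_mul_norm (k : ZMod p) :
    |(p : ℝ) - 2 * k.val| ≤ p * (‖1 + χ (-k)‖ / 2) := by
  have hp0 : (0 : ℝ) < p := by exact_mod_cast (Fact.out : p.Prime).pos
  have hk : (k.val : ℝ) < p := by exact_mod_cast ZMod.val_lt k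
  set t : ℝ := Real.pi * k.val / p with ht
  have h1 : ‖1 + χ (-k)‖ = 2 * |Real.cos t| := by
    have hχ : χ k = Complex.exp (2 * (t * Complex.I)) := by
      rw [ZMod.stdAddChar_apply, ZMod.toCircle_apply, ht]
      congr 1
      push_cast
      ring
    rw [AddChar.map_neg_eq_conj, ← Complex.norm_conj, map_add, map_one, Complex.conj_conj, hχ]
    have : 1 + Complex.exp (2 * (t * Complex.I)) =
        Complex.exp (t * Complex.I) * ((2 * Real.cos t : ℝ) : ℂ) := by
      push_cast
      rw [Complex.two_cos, mul_add, ← Complex.exp_add, ← Complex.exp_add]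
      ring_nf
      simp [add_comm]
    rw [this, norm_mul, Complex.norm_exp_ofReal_mul_I, one_mul, Complex.norm_real,
      Real.norm_eq_abs, abs_mul, abs_two]
  have h2 : Real.pi / 2 - t = Real.pi / 2 * (((p : ℝ) - 2 * k.val) / p) := by
    rw [ht]
    field_simp
  have h3 : |((p : ℝ) - 2 * k.val) / p| ≤ 1 := by
    rw [abs_div, abs_of_pos hp0, div_le_one hp0, abs_le]
    constructor <;> linarith [Nat.cast_nonneg (α := ℝ) k.val]
  have hpi := Real.pi_pos
  have h4 := Real.mul_abs_le_abs_sin (x := Real.pi / 2 - t) (by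
    rw [h2, abs_mul, abs_of_pos (by positivity)]
    exact mul_le_of_le_one_right (by positivity) h3)
  rw [Real.sin_pi_div_two_sub, h2, abs_mul, abs_of_pos (by positivity : 0 < Real.pi / 2),
    ← mul_assoc, show 2 / Real.pi * (Real.pi / 2) = 1 by field_simp, one_mul, abs_div,
    abs_of_pos hp0, div_le_iff₀ hp0] at h4
  rw [h1]
  linarith

theorem dft_oddIndicator_mul (hp : p ≠ 2) (k : ZMod p) (hk : k ≠ 0) :
    ZMod.dft (oddIndicator p) k * (1 + χ (-k)) = -1 := by
  obtain ⟨q, hq⟩ := (Fact.out : p.Prime).odd_of_ne_two hp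
  set z := χ (-k) with hz
  have hz1 : z - 1 ≠ 0 := by
    rw [sub_ne_zero, hz, ← AddChar.map_zero_eq_one χ, ZMod.injective_stdAddChar.ne_iff]
    simpa
  have hzp : z ^ (2 * q + 1) = 1 := by
    rw [← hq, hz, ← AddChar.map_nsmul_eq_pow]
    simp
  have h : ZMod.dft (oddIndicator p) k = ∑ j ∈ range q, z ^ (2 * j + 1) := by
    rw [← Finset.sum_range_ite_odd (fun i ↦ z ^ i), ← hq, ZMod.dft_apply, ZMod.sum_eq_sum_range]
    refine sum_congr rfl fun i hi ↦ ?_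
    rw [oddIndicator, ZMod.val_cast_of_lt (mem_range.1 hi), hz, ← AddChar.map_nsmul_eq_pow]
    simp
  have hg : (∑ j ∈ range q, z ^ (2 * j + 1)) * (z ^ 2 - 1) = 1 - z := by
    have := geom_sum_mul (z ^ 2) q
    simp only [pow_succ _ (2 * _), pow_mul, ← sum_mul]
    rw [pow_succ, pow_mul] at hzp
    linear_combination z * this + hzp
  apply mul_right_cancel₀ hz1
  rw [h]
  linear_combination hg

theorem norm_dft_oddIndicator_le (hp : p ≠ 2) (k : ZMod p) (hk : k ≠ 0) :
    ‖ZMod.dft (oddIndicator p) k‖ ≤ p / 2 * |(p : ℝ) - 2 * k.val|⁻¹ := by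
  have h := congr_arg norm (dft_oddIndicator_mul hp k hk)
  rw [norm_mul, norm_neg, norm_one] at h
  have h' := abs_sub_two_mul_val_le_mul_norm k
  have hne : (p : ℝ) - 2 * k.val ≠ 0 := by
    obtain ⟨q, hq⟩ := (Fact.out : p.Prime).odd_of_ne_two hp
    rw [sub_ne_zero]
    norm_cast
    omega
  rw [← div_eq_mul_inv, le_div_iff₀ (abs_pos.2 hne)]
  calc _ ≤ ‖ZMod.dft (oddIndicator p) k‖ * (p * (‖1 + χ (-k)‖ / 2)) := by gcongr
    _ = p / 2 * (‖ZMod.dft (oddIndicator p) k‖ * ‖1 + χ (-k)‖) := by ring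
    _ = p / 2 := by rw [h, mul_one]

theorem sum_oddIndicator {q : ℕ} (hq : p = 2 * q + 1) : ∑ x, oddIndicator p x = q := by
  have := Finset.sum_range_ite_odd (fun _ ↦ (1 : ℂ)) q
  rw [ZMod.sum_eq_sum_range]
  rw [← hq] at this
  simp only [sum_const, card_range, nsmul_eq_mul, mul_one] at this
  rw [← this]
  refine sum_congr rfl fun i hi ↦ ?_
  rw [oddIndicator, ZMod.val_cast_of_lt (mem_range.1 hi)]

end ExponentialSums

theorem sum_inv_two_mul_add_one_le (n : ℕ) :
    ∑ j ∈ range n, ((2 * j + 1 : ℝ))⁻¹ ≤ 1 + Real.log n := by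
  refine le_trans ?_ (harmonic_le_one_add_log n)
  rw [harmonic]
  push_cast
  refine sum_le_sum fun j _ ↦ inv_anti₀ (by positivity) ?_
  linarith [Nat.cast_nonneg (α := ℝ) j]

theorem sum_inv_abs_sub_two_mul_le {p : ℕ} (hp : Odd p) :
    ∑ i ∈ range p, |(p : ℝ) - 2 * i|⁻¹ ≤ 2 * (1 + Real.log p) := by
  obtain ⟨q, rfl⟩ := hp
  have hlog (n : ℕ) (hn : n ≤ 2 * q + 1) : Real.log n ≤ Real.log (2 * q + 1 : ℕ) := by
    rcases n.eq_zero_or_pos with rfl | h0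
    · simpa using Real.log_natCast_nonneg (2 * q + 1)
    · gcongr
  rw [show range (2 * q + 1) = range (q + 1 + q) by congr 1; ring, sum_range_add,
    ← sum_range_reflect, two_mul (1 + Real.log _)]
  refine add_le_add ?_ ?_
  · refine le_trans (le_of_eq ?_) ((sum_inv_two_mul_add_one_le (q + 1)).trans
      (by linarith [hlog (q + 1) (by omega)]))
    refine sum_congr rfl fun j hj ↦ ?_
    have hj : j ≤ q := by simpa [Nat.lt_succ_iff] using hj
    rw [Nat.add_sub_cancel, Nat.cast_sub hj, ← abs_of_nonneg (by positivity : (0 : ℝ) ≤ 2 * j + 1)]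
    congr 2
    push_cast
    ring
  · refine le_trans (le_of_eq ?_) ((sum_inv_two_mul_add_one_le q).trans
      (by linarith [hlog q (by omega)]))
    refine sum_congr rfl fun j _ ↦ ?_
    rw [← abs_of_nonneg (by positivity : (0 : ℝ) ≤ 2 * j + 1), abs_sub_comm]
    congr 2
    push_cast
    ring

section Counting

variable {p : ℕ} [Fact p.Prime]

theorem sum_norm_dft_oddIndicator_le (hp : p ≠ 2) :
    ∑ k, ‖ZMod.dft (oddIndicator p) k‖ ≤ p * (2 + Real.log p) := by
  have hodd := (Fact.out : p.Prime).odd_of_ne_two hp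
  have hle (k : ZMod p) : ‖ZMod.dft (oddIndicator p) k‖ ≤
      (if k = 0 then (p : ℝ) else 0) + p / 2 * |(p : ℝ) - 2 * k.val|⁻¹ := by
    split_ifs with hk
    · obtain ⟨q, hq⟩ := hodd
      have hq' : (q : ℝ) ≤ p := by exact_mod_cast (by omega : q ≤ p)
      rw [hk, ZMod.dft_apply_zero, sum_oddIndicator hq, Complex.norm_natCast]
      have : 0 ≤ (p : ℝ) / 2 * |(p : ℝ) - 2 * (0 : ZMod p).val|⁻¹ := by positivity
      linarith
    · rw [zero_add]
      exact norm_dft_oddIndicator_le hp k hk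
  refine (sum_le_sum fun k _ ↦ hle k).trans ?_
  rw [sum_add_distrib, ← mul_sum, ZMod.sum_eq_sum_range p fun k ↦ |(p : ℝ) - 2 * k.val|⁻¹]
  have h : ∑ i ∈ range p, |(p : ℝ) - 2 * (i : ZMod p).val|⁻¹ ≤ 2 * (1 + Real.log p) := by
    refine le_trans (le_of_eq (sum_congr rfl fun i hi ↦ ?_)) (sum_inv_abs_sub_two_mul_le hodd)
    rw [ZMod.val_cast_of_lt (mem_range.1 hi)]
  have := mul_le_mul_of_nonneg_left h (by positivity : (0 : ℝ) ≤ p / 2)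
  simp only [sum_ite_eq', mem_univ, if_true]
  linarith

theorem card_odd_val {q : ℕ} (hq : p = 2 * q + 1) : #{x : ZMod p | Odd x.val} = q := by
  have h := sum_oddIndicator hq
  simp only [oddIndicator, sum_boole] at h
  exact_mod_cast h

theorem le_card_odd_val_and_odd_val (hp : p ≠ 2) :
    (p : ℝ) / 4 - 1 / 2 - √p * (2 + Real.log p) ^ 2 ≤
      #{n : ZMod p | Odd n.val ∧ Odd (n ^ 2 - n).val} := by
  obtain ⟨q, hq⟩ := (Fact.out : p.Prime).odd_of_ne_two hp
  have hp0 : (0 : ℝ) < p := by exact_mod_cast (Fact.out : p.Prime).pos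
  have hL := Real.log_natCast_nonneg p
  set N := #{n : ZMod p | Odd n.val ∧ Odd (n ^ 2 - n).val} with hN
  have hcount : ∑ n, oddIndicator p n * oddIndicator p (n ^ 2 - n) = (N : ℂ) := by
    simp only [oddIndicator, ite_mul, one_mul, zero_mul, ← ite_and, sum_boole, hN]
  have h := norm_sum_mul_sub_le hp (oddIndicator p) (oddIndicator p)
  rw [hcount, sum_oddIndicator hq] at h
  have hA := sum_norm_dft_oddIndicator_le hp
  have hA0 : 0 ≤ ∑ k, ‖ZMod.dft (oddIndicator p) k‖ := by positivity
  have hbound : ((p : ℝ)⁻¹) ^ 2 * (√p * ((∑ k, ‖ZMod.dft (oddIndicator p) k‖) *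
      ∑ k, ‖ZMod.dft (oddIndicator p) k‖)) ≤ √p * (2 + Real.log p) ^ 2 := by
    calc _ ≤ ((p : ℝ)⁻¹) ^ 2 * (√p * ((p * (2 + Real.log p)) * (p * (2 + Real.log p)))) := by
          gcongr
      _ = _ := by field_simp
  have hcast : (N : ℂ) - (p : ℂ)⁻¹ * (q * q) = ((N - (p : ℝ)⁻¹ * (q * q) : ℝ) : ℂ) := by
    push_cast
    rfl
  rw [hcast, Complex.norm_real, Real.norm_eq_abs] at h
  have h' := (abs_le.1 (h.trans hbound)).1
  have hq' : (p : ℝ) / 4 - 1 / 2 ≤ (p : ℝ)⁻¹ * (q * q) := by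
    rw [inv_mul_eq_div, le_div_iff₀ hp0, show (p : ℝ) = 2 * q + 1 by exact_mod_cast hq]
    nlinarith
  linarith

theorem card_le_two_mul_card_image_sq_sub (s : Finset (ZMod p)) :
    #s ≤ 2 * #(s.image fun n ↦ n ^ 2 - n) := by
  refine card_le_mul_card_image s 2 fun a ha ↦ ?_
  obtain ⟨m, -, rfl⟩ := mem_image.1 ha
  refine (card_le_card (t := {m, 1 - m}) fun n hn ↦ ?_).trans card_le_two
  have h := (mem_filter.1 hn).2
  have h0 : (n - m) * (n - (1 - m)) = 0 := by linear_combination h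
  rcases mul_eq_zero.1 h0 with h | h
  · simp [sub_eq_zero.1 h]
  · simp [sub_eq_zero.1 h]

theorem exists_factorial_mul_factorial_eq_neg {k : ZMod p} (hp : p ≠ 2) (hk : Odd k.val) :
    ∃ n₁ n₂ : ℕ, n₁ ∈ Icc 1 (p - 1) ∧ n₂ ∈ Icc 1 (p - 1) ∧
      (n₁.factorial : ZMod p) * (n₂.factorial : ZMod p) = -k := by
  have hlt := ZMod.val_lt k
  have hodd := (Fact.out : p.Prime).odd_of_ne_two hp
  obtain ⟨m, hm⟩ := hk
  obtain ⟨q, hq⟩ := hodd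
  have hw := factorial_mul_factorial_sub p (2 * m) (by omega)
  refine ⟨2 * m + 1, p - 1 - 2 * m, mem_Icc.2 (by omega), mem_Icc.2 (by omega), ?_⟩
  rw [pow_succ, pow_mul] at hw
  rw [← ZMod.natCast_zmod_val k, hm, Nat.factorial_succ]
  push_cast
  simp only [neg_one_sq, one_pow] at hw
  linear_combination (2 * m + 1 : ZMod p) * hw

theorem exists_factorial_mul_factorial_eq_sq_sub {n : ZMod p} (hn : Odd n.val)
    (hn' : Odd (n ^ 2 - n).val) :
    ∃ n₁ n₂ : ℕ, n₁ ∈ Icc 1 (p - 1) ∧ n₂ ∈ Icc 1 (p - 1) ∧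
      (n₁.factorial : ZMod p) * (n₂.factorial : ZMod p) = n ^ 2 - n := by
  have hlt := ZMod.val_lt n
  have hn1 : n.val ≠ 1 := by
    intro h
    have : n = 1 := by rw [← ZMod.natCast_zmod_val n, h, Nat.cast_one]
    simp [this] at hn'
  obtain ⟨m, hm⟩ := hn
  obtain ⟨m, rfl⟩ : ∃ l, m = l + 1 := ⟨m - 1, by omega⟩
  have hw := factorial_mul_factorial_sub p (2 * m + 1) (by omega)
  refine ⟨2 * m + 1 + 1 + 1, p - 1 - (2 * m + 1), mem_Icc.2 (by omega),
    mem_Icc.2 (by omega), ?_⟩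
  rw [show 2 * m + 1 + 1 = 2 * (m + 1) by ring, pow_mul] at hw
  rw [← ZMod.natCast_zmod_val n, hm, Nat.factorial_succ, Nat.factorial_succ]
  push_cast
  simp only [neg_one_sq, one_pow] at hw
  linear_combination (2 * m + 1 + 1 : ZMod p) * (2 * m + 1 + 1 + 1) * hw

end Counting

/-- Theorem 12 (lower bound for `V_2(0, p-1)`): there is an absolute constant
`C > 0` such that for every odd prime `p`, the number of nonzero residue
classes `a` mod `p` representable as `a ≡ n_1! n_2! (mod p)` with
`1 ≤ n_1, n_2 ≤ p - 1` is at least `(5/8) p - C p^{1/2} (log p)²`. -/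
theorem value_set_two_factorials_lower_bound :
    ∃ C : ℝ, 0 < C ∧ ∀ p : ℕ, p.Prime → Odd p →
      (5 : ℝ) / 8 * (p : ℝ) - C * (p : ℝ) ^ ((1 : ℝ) / 2) * (Real.log p) ^ 2 ≤
        ({a : ZMod p | a ≠ 0 ∧ ∃ n₁ n₂ : ℕ, n₁ ∈ Finset.Icc 1 (p - 1) ∧
            n₂ ∈ Finset.Icc 1 (p - 1) ∧
              ((n₁.factorial : ZMod p)) * ((n₂.factorial : ZMod p)) = a}.ncard : ℝ) := by
  refine ⟨6, by norm_num, fun p hprime hodd ↦ ?_⟩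
  have := Fact.mk hprime
  have hp : p ≠ 2 := by rintro rfl; exact absurd hodd (by decide)
  have hp3 : 3 ≤ p := by have := hprime.two_le; omega
  obtain ⟨q, hq⟩ := hodd
  set T : Set (ZMod p) := {a : ZMod p | a ≠ 0 ∧ ∃ n₁ n₂ : ℕ, n₁ ∈ Finset.Icc 1 (p - 1) ∧
    n₂ ∈ Finset.Icc 1 (p - 1) ∧ ((n₁.factorial : ZMod p)) * ((n₂.factorial : ZMod p)) = a}
  set N : Finset (ZMod p) := {n : ZMod p | Odd n.val ∧ Odd (n ^ 2 - n).val}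
  set E : Finset (ZMod p) := ({x : ZMod p | Odd x.val} : Finset (ZMod p)).image Neg.neg
  set O : Finset (ZMod p) := N.image fun n ↦ n ^ 2 - n
  have hne {x : ZMod p} (hx : Odd x.val) : x ≠ 0 := by rintro rfl; simp at hx
  have hdisj : Disjoint E O := by
    rw [Finset.disjoint_left]
    rintro _ hx hx'
    obtain ⟨x, hxodd, rfl⟩ := Finset.mem_image.1 hx
    obtain ⟨n, hn, hnx⟩ := Finset.mem_image.1 hx'
    have hxodd := (Finset.mem_filter.1 hxodd).2
    have hn := (Finset.mem_filter.1 hn).2.2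
    have := ZMod.val_lt x
    rw [hnx, ZMod.neg_val, if_neg (hne hxodd)] at hn
    grind
  have hsub : ((E ∪ O : Finset (ZMod p)) : Set (ZMod p)) ⊆ T := by
    intro a ha
    rcases Finset.mem_union.1 (Finset.mem_coe.1 ha) with ha | ha
    · obtain ⟨x, hx, rfl⟩ := Finset.mem_image.1 ha
      have hx := (Finset.mem_filter.1 hx).2
      exact ⟨neg_ne_zero.2 (hne hx), exists_factorial_mul_factorial_eq_neg hp hx⟩
    · obtain ⟨n, hn, rfl⟩ := Finset.mem_image.1 ha
      have hn := (Finset.mem_filter.1 hn).2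
      exact ⟨hne hn.2, exists_factorial_mul_factorial_eq_sq_sub hn.1 hn.2⟩
  have hcard := Set.ncard_le_ncard hsub (Set.toFinite T)
  rw [Set.ncard_coe_finset, Finset.card_union_of_disjoint hdisj,
    Finset.card_image_of_injective _ neg_injective, card_odd_val hq] at hcard
  have hNO : (N.card : ℝ) ≤ 2 * O.card := by
    exact_mod_cast card_le_two_mul_card_image_sq_sub N
  have hcard' : (q : ℝ) + O.card ≤ T.ncard := by exact_mod_cast hcard
  have hlow := le_card_odd_val_and_odd_val hp
  have hlog : 1 ≤ Real.log p := by
    rw [Real.le_log_iff_exp_le (by positivity)]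
    have : (3 : ℝ) ≤ p := by exact_mod_cast hp3
    linarith [Real.exp_one_lt_d9]
  have hsqrt : 1 ≤ √(p : ℝ) := by
    rw [Real.one_le_sqrt]
    exact_mod_cast hprime.one_le
  have hqp : (p : ℝ) = 2 * q + 1 := by exact_mod_cast hq
  have hsq : (2 + Real.log p) ^ 2 ≤ 9 * Real.log p ^ 2 := by nlinarith
  have hmul : √p * (2 + Real.log p) ^ 2 ≤ √p * (9 * Real.log p ^ 2) := by gcongr
  have hone : 1 ≤ √p * Real.log p ^ 2 := one_le_mul_of_one_le_of_one_le hsqrt (one_le_pow₀ hlog)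
  rw [← Real.sqrt_eq_rpow]
  linarith
end

section
/- There exists a threshold p_0 such that for every prime p ≥ p_0 and every integer a, there exist positive integers n_1, n_2, n_3, n_4 such that n_1! n_2! + n_3! n_4! ≡ a (mod p). -/
/-- A symmetric form of Wilson's theorem. -/
theorem factorial_mul_factorial_sub_eq_neg_one_pow {p : ℕ} [Fact p.Prime] (k : ℕ) (hk : k < p) :
    (k.factorial : ZMod p) * ((p - 1 - k).factorial : ZMod p) = (-1) ^ (k + 1) := by
  induction k with
  | zero => simp [ZMod.wilsons_lemma]
  | succ k ih =>
    have h := ih (by omega)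
    obtain ⟨m, rfl⟩ : ∃ m, p = m + k + 2 := ⟨p - k - 2, by omega⟩
    have hm : (m + k + 2 - 1 - k) = m + 1 := by omega
    have hm' : (m + k + 2 - 1 - (k + 1)) = m := by omega
    rw [hm, Nat.factorial_succ] at h
    rw [hm', Nat.factorial_succ]
    have hp : ((m + k + 2 : ℕ) : ZMod (m + k + 2)) = 0 := ZMod.natCast_self _
    push_cast at h hp ⊢
    linear_combination
      -h + (k.factorial : ZMod (m + k + 2)) * (m.factorial : ZMod (m + k + 2)) * hp

/-- Every even residue in `[0, p)` is a product of two factorials modulo `p`. -/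
theorem exists_factorial_mul_factorial_eq_of_even {p : ℕ} [Fact p.Prime] {k : ℕ}
    (hk : k < p) (heven : Even k) :
    ∃ n m : ℕ, 0 < n ∧ 0 < m ∧ (n.factorial : ZMod p) * (m.factorial : ZMod p) = (k : ZMod p) := by
  have hp : p.Prime := Fact.out
  rcases k with _ | k
  · refine ⟨p, 1, hp.pos, one_pos, ?_⟩
    have h : (p.factorial : ZMod p) = 0 :=
      (ZMod.natCast_eq_zero_iff _ _).2 (Nat.dvd_factorial hp.pos le_rfl)
    simp [h]
  · refine ⟨k + 1, p - 1 - k, k.succ_pos, by omega, ?_⟩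
    have h := factorial_mul_factorial_sub_eq_neg_one_pow (p := p) k (by omega)
    rw [heven.neg_one_pow] at h
    rw [Nat.factorial_succ, Nat.cast_mul, mul_assoc, h, mul_one]

/-- For every sufficiently large prime `p`, every integer `a` can be written as
`a ≡ n_1! n_2! + n_3! n_4! (mod p)` with positive integers `n_1, n_2, n_3, n_4`. -/
theorem sum_of_two_products_of_two_factorials :
    ∃ p₀ : ℕ, ∀ p : ℕ, p.Prime → p₀ ≤ p →
      ∀ a : ℤ, ∃ n₁ n₂ n₃ n₄ : ℕ, 0 < n₁ ∧ 0 < n₂ ∧ 0 < n₃ ∧ 0 < n₄ ∧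
        ((n₁.factorial : ZMod p)) * ((n₂.factorial : ZMod p)) +
            ((n₃.factorial : ZMod p)) * ((n₄.factorial : ZMod p)) = (a : ZMod p) := by
  refine ⟨3, fun p hp hp3 a => ?_⟩
  have : Fact p.Prime := ⟨hp⟩
  suffices h : ∃ k l : ℕ, k < p ∧ l < p ∧ Even k ∧ Even l ∧
      (k : ZMod p) + (l : ZMod p) = (a : ZMod p) by
    obtain ⟨k, l, hk, hl, hke, hle, h⟩ := h
    obtain ⟨n₁, n₂, h₁, h₂, h₁₂⟩ := exists_factorial_mul_factorial_eq_of_even hk hke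
    obtain ⟨n₃, n₄, h₃, h₄, h₃₄⟩ := exists_factorial_mul_factorial_eq_of_even hl hle
    exact ⟨n₁, n₂, n₃, n₄, h₁, h₂, h₃, h₄, by rw [h₁₂, h₃₄, h]⟩
  have hodd : Odd p := hp.odd_of_ne_two (by omega)
  have hlt : (a : ZMod p).val < p := ZMod.val_lt _
  have hval : (((a : ZMod p).val : ℕ) : ZMod p) = a := ZMod.natCast_zmod_val _
  generalize (a : ZMod p).val = r at hlt hval
  rcases Nat.even_or_odd r with hr | hr
  · exact ⟨r, 0, hlt, hp.pos, hr, Even.zero, by simpa using hval⟩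
  · refine ⟨p - 1, r + 1, by omega, by grind, by grind, hr.add_one, ?_⟩
    rw [← Nat.cast_add, show p - 1 + (r + 1) = p + r by omega]
    simpa using hval
end
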